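/- Fix r ∈ (0,1). If K ∈ 𝔄_{m_1}^{r} and K′ ∈ 𝔄_{m_2}^{r} (with m_1, m_2 ≥ 2 integers), then K and K′ are bilipschitz equivalent if and only if they have the same Hausdorff dimension (equivalently, if and only if m_1 = m_2). -/

import Mathlib

open scoped Classical

/-- The symbolic space metric on `ℕ → Fin m`: `d(x,y) = r ^ (min {k | x k ≠ y k})`
for `x ≠ y`, and `d(x,x) = 0`. -/
noncomputable def symbDist (r : ℝ) {m : ℕ} (x y : ℕ → Fin m) : ℝ :=
  if x = y then 0 else r ^ sInf {k : ℕ | x k ≠ y k}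

/-- `K` (a subset of a metric space) is bilipschitz equivalent to the symbolic
space `Σ_m^r`. -/
def BilipWithSymb {X : Type*} [MetricSpace X] (K : Set X) (m : ℕ) (r : ℝ) : Prop :=
  ∃ f : K → (ℕ → Fin m), Function.Bijective f ∧ ∃ C : ℝ, 1 ≤ C ∧ ∀ x y : K,
    C⁻¹ * dist x y ≤ symbDist r (f x) (f y) ∧ symbDist r (f x) (f y) ≤ C * dist x y

/-- `K ⊆ X` and `K' ⊆ X'` are bilipschitz equivalent (as metric spaces with the
induced metrics). -/
def BilipEquivSets {X Y : Type*} [MetricSpace X] [MetricSpace Y]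
    (K : Set X) (K' : Set Y) : Prop :=
  ∃ f : K → K', Function.Bijective f ∧ ∃ C : ℝ, 1 ≤ C ∧ ∀ x y : K,
    C⁻¹ * dist x y ≤ dist (f x) (f y) ∧ dist (f x) (f y) ≤ C * dist x y

/-- Dust-like graph-directed sets with ratio `r` on a directed graph with `p`
vertices, where `a i j` is the number of edges from `i` to `j`:
nonempty compact sets `K i` with `K i = ⋃_j ⋃_{e : Fin (a i j)} S i j e '' (K j)`,
the union being pairwise disjoint, each `S i j e` a similitude of ratio `r`. -/
structure GraphDirected (X : Type*) [MetricSpace X] (p : ℕ) (r : ℝ) where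
  a : Fin p → Fin p → ℕ
  S : ∀ i j : Fin p, Fin (a i j) → X → X
  sim : ∀ i j e x y, dist (S i j e x) (S i j e y) = r * dist x y
  K : Fin p → Set X
  nonempty : ∀ i, (K i).Nonempty
  compact : ∀ i, IsCompact (K i)
  union : ∀ i, K i = ⋃ j, ⋃ e, S i j e '' K j
  disj : ∀ i : Fin p, ∀ j j' : Fin p, ∀ e : Fin (a i j), ∀ e' : Fin (a i j'),
    (⟨j, e⟩ : Σ j, Fin (a i j)) ≠ ⟨j', e'⟩ →
    Disjoint (S i j e '' K j) (S i j' e' '' K j')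

/-- The family has integer characteristic `m`: there is a positive vector `v`
with `A v = m v`, `A` being the adjacency matrix. -/
def GraphDirected.HasCharacteristic {X : Type*} [MetricSpace X] {p : ℕ} {r : ℝ}
    (G : GraphDirected X p r) (m : ℕ) : Prop :=
  ∃ v : Fin p → ℝ, (∀ i, 0 < v i) ∧ ∀ i, ∑ j, (G.a i j : ℝ) * v j = (m : ℝ) * v i

/-- `K` belongs to the class `𝔄_m^r`: `K = K_1` for some dust-like
graph-directed sets `{K_1, …, K_p}` with ratio `r` and integer characteristic `m`. -/
def MemGDClass {X : Type*} [MetricSpace X] (K : Set X) (r : ℝ) (m : ℕ) : Prop :=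
  ∃ (p : ℕ) (hp : 0 < p) (G : GraphDirected X p r),
    G.HasCharacteristic m ∧ K = G.K ⟨0, hp⟩


namespace GDP

def BE {X Y : Type*} [MetricSpace X] [MetricSpace Y] (A : Set X) (B : Set Y) : Prop :=
  ∃ (H : X → Y → Prop) (C : ℝ), 0 < C ∧ (∀ x y, H x y → x ∈ A ∧ y ∈ B) ∧
    (∀ x ∈ A, ∃ y, H x y) ∧ (∀ y ∈ B, ∃ x, H x y) ∧
    ∀ x y x' y', H x y → H x' y' → dist x x' ≤ C * dist y y' ∧ dist y y' ≤ C * dist x x'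

section be
variable {X Y Z : Type*} [MetricSpace X] [MetricSpace Y] [MetricSpace Z]

theorem BE.symm {A : Set X} {B : Set Y} (h : BE A B) : BE B A := by
  obtain ⟨H, C, hC, h1, h2, h3, h4⟩ := h
  refine ⟨fun y x => H x y, C, hC, fun y x h => (h1 x y h).symm, h3, h2, ?_⟩
  intro y x y' x' ha hb
  exact (h4 x y x' y' ha hb).symm

theorem BE.trans {A : Set X} {B : Set Y} {D : Set Z} (h : BE A B) (h' : BE B D) : BE A D := by
  obtain ⟨H, C, hC, h1, h2, h3, h4⟩ := h
  obtain ⟨H', C', hC', h1', h2', h3', h4'⟩ := h'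
  refine ⟨fun x z => ∃ y, H x y ∧ H' y z, C * C', by positivity, ?_, ?_, ?_, ?_⟩
  · rintro x z ⟨y, a, b⟩
    exact ⟨(h1 _ _ a).1, (h1' _ _ b).2⟩
  · intro x hx
    obtain ⟨y, hy⟩ := h2 x hx
    obtain ⟨z, hz⟩ := h2' y (h1 _ _ hy).2
    exact ⟨z, y, hy, hz⟩
  · intro z hz
    obtain ⟨y, hy⟩ := h3' z hz
    obtain ⟨x, hx⟩ := h3 y (h1' _ _ hy).1
    exact ⟨x, y, hx, hy⟩
  · rintro x z x' z' ⟨y, a, b⟩ ⟨y', a', b'⟩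
    obtain ⟨u1, u2⟩ := h4 _ _ _ _ a a'
    obtain ⟨w1, w2⟩ := h4' _ _ _ _ b b'
    constructor
    · calc dist x x' ≤ C * dist y y' := u1
        _ ≤ C * (C' * dist z z') := by gcongr
        _ = _ := by ring
    · calc dist z z' ≤ C' * dist y y' := w2
        _ ≤ C' * (C * dist x x') := by gcongr
        _ = _ := by ring

theorem BE.empty : BE (∅ : Set X) (∅ : Set Y) :=
  ⟨fun _ _ => False, 1, one_pos, by simp, by simp, by simp, by simp⟩

theorem BE.image {A : Set X} {c : ℝ} (hc : 0 < c) (S : X → Y)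
    (hS : ∀ x ∈ A, ∀ y ∈ A, dist (S x) (S y) = c * dist x y) : BE A (S '' A) := by
  refine ⟨fun x y => x ∈ A ∧ y = S x, max c c⁻¹, by positivity, ?_, ?_, ?_, ?_⟩
  · rintro x y ⟨h, rfl⟩
    exact ⟨h, x, h, rfl⟩
  · intro x hx
    exact ⟨_, hx, rfl⟩
  · rintro y ⟨x, hx, rfl⟩
    exact ⟨x, hx, rfl⟩
  · rintro x y x' y' ⟨hx, rfl⟩ ⟨hx', rfl⟩
    rw [hS x hx x' hx']
    constructor
    · calc dist x x' = c⁻¹ * (c * dist x x') := by field_simp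
        _ ≤ _ := by gcongr; exact le_max_right _ _
    · gcongr
      exact le_max_left _ _

theorem compact_sep {A B : Set X} (hA : IsCompact A) (hB : IsCompact B) (h : Disjoint A B) :
    ∃ δ : ℝ, 0 < δ ∧ ∀ x ∈ A, ∀ y ∈ B, δ ≤ dist x y := by
  obtain ⟨r, hr, h⟩ := Metric.exists_pos_forall_lt_edist hA hB.isClosed h
  refine ⟨r, hr, fun x hx y hy => ?_⟩
  have := h x hx y hy
  rw [edist_nndist] at this
  exact_mod_cast this.le

theorem compact_bdd {A : Set X} (hA : IsCompact A) :
    ∃ D : ℝ, 0 < D ∧ ∀ x ∈ A, ∀ y ∈ A, dist x y ≤ D := by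
  obtain ⟨D, hD⟩ := Metric.isBounded_iff.1 hA.isBounded
  exact ⟨max D 1, by positivity, fun x hx y hy => (hD hx hy).trans (le_max_left _ _)⟩

theorem finite_min {ι : Type*} [Finite ι] (P : ι → ℝ → Prop)
    (hP : ∀ i a b, 0 < b → b ≤ a → P i a → P i b) (h : ∀ i, ∃ a, 0 < a ∧ P i a) :
    ∃ a, 0 < a ∧ ∀ i, P i a := by
  choose a ha hpa using h
  cases nonempty_fintype ι
  by_cases hne : Nonempty ι
  · obtain ⟨i0, -, hi0⟩ := Finset.exists_min_image Finset.univ a Finset.univ_nonempty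
    exact ⟨a i0, ha i0, fun i => hP i _ _ (ha i0) (hi0 i (Finset.mem_univ _)) (hpa i)⟩
  · exact ⟨1, one_pos, fun i => (hne ⟨i⟩).elim⟩

theorem finite_max {ι : Type*} [Finite ι] (P : ι → ℝ → Prop)
    (hP : ∀ i a b, 0 < a → a ≤ b → P i a → P i b) (h : ∀ i, ∃ a, 0 < a ∧ P i a) :
    ∃ a, 0 < a ∧ ∀ i, P i a := by
  choose a ha hpa using h
  cases nonempty_fintype ι
  by_cases hne : Nonempty ι
  · obtain ⟨i0, -, hi0⟩ := Finset.exists_max_image Finset.univ a Finset.univ_nonempty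
    exact ⟨a i0, ha i0, fun i => hP i _ _ (ha i) (hi0 i (Finset.mem_univ _)) (hpa i)⟩
  · exact ⟨1, one_pos, fun i => (hne ⟨i⟩).elim⟩

theorem BE.union {A A' : Set X} {B B' : Set Y} (h : BE A B) (h' : BE A' B')
    (cA : IsCompact A) (cA' : IsCompact A') (cB : IsCompact B) (cB' : IsCompact B')
    (dA : Disjoint A A') (dB : Disjoint B B') : BE (A ∪ A') (B ∪ B') := by
  obtain ⟨H, C, hC, h1, h2, h3, h4⟩ := h
  obtain ⟨H', C', hC', h1', h2', h3', h4'⟩ := h'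
  obtain ⟨δ, hδ, hs⟩ := compact_sep cA cA' dA
  obtain ⟨ε, hε, ht⟩ := compact_sep cB cB' dB
  obtain ⟨D, hD, hb⟩ := compact_bdd (cA.union cA')
  obtain ⟨D', hD', hb'⟩ := compact_bdd (cB.union cB')
  have key : ∀ x y x' y', H x y → H' x' y' →
      dist x x' ≤ (C + C' + D / ε + D' / δ) * dist y y' ∧
      dist y y' ≤ (C + C' + D / ε + D' / δ) * dist x x' := by
    intro x y x' y' a b
    obtain ⟨p1, p2⟩ := h1 _ _ a
    obtain ⟨p1', p2'⟩ := h1' _ _ b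
    constructor
    · calc dist x x' ≤ D := hb _ (Or.inl p1) _ (Or.inr p1')
        _ = D / ε * ε := by field_simp
        _ ≤ D / ε * dist y y' := by gcongr; exact ht _ p2 _ p2'
        _ ≤ _ := by gcongr; have : 0 < D' / δ := by positivity
                    linarith
    · calc dist y y' ≤ D' := hb' _ (Or.inl p2) _ (Or.inr p2')
        _ = D' / δ * δ := by field_simp
        _ ≤ D' / δ * dist x x' := by gcongr; exact hs _ p1 _ p1'
        _ ≤ _ := by gcongr; have : 0 < D / ε := by positivity
                    linarith
  have e1 : 0 < D / ε := by positivity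
  have e2 : 0 < D' / δ := by positivity
  refine ⟨fun x y => H x y ∨ H' x y, C + C' + D / ε + D' / δ, by positivity, ?_, ?_, ?_, ?_⟩
  · rintro x y (a | a)
    · exact ⟨Or.inl (h1 _ _ a).1, Or.inl (h1 _ _ a).2⟩
    · exact ⟨Or.inr (h1' _ _ a).1, Or.inr (h1' _ _ a).2⟩
  · rintro x (a | a)
    · obtain ⟨y, hy⟩ := h2 x a
      exact ⟨y, Or.inl hy⟩
    · obtain ⟨y, hy⟩ := h2' x a
      exact ⟨y, Or.inr hy⟩
  · rintro x (a | a)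
    · obtain ⟨y, hy⟩ := h3 x a
      exact ⟨y, Or.inl hy⟩
    · obtain ⟨y, hy⟩ := h3' x a
      exact ⟨y, Or.inr hy⟩
  · rintro x y x' y' (a | a) (b | b)
    · obtain ⟨u1, u2⟩ := h4 _ _ _ _ a b
      constructor
      · refine u1.trans ?_
        gcongr
        linarith
      · refine u2.trans ?_
        gcongr
        linarith
    · exact key _ _ _ _ a b
    · have := key _ _ _ _ b a
      rwa [dist_comm x' x, dist_comm y' y] at this
    · obtain ⟨u1, u2⟩ := h4' _ _ _ _ a b
      constructor
      · refine u1.trans ?_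
        gcongr
        linarith
      · refine u2.trans ?_
        gcongr
        linarith

theorem BE.dimH_le {A : Set X} {B : Set Y} (h : BE A B) : dimH B ≤ dimH A := by
  obtain ⟨H, C, hC, h1, h2, h3, h4⟩ := h
  by_cases hB : Nonempty Y
  · let f : X → Y := fun x => if h : ∃ y, H x y then h.choose else hB.some
    have hf : ∀ x ∈ A, H x (f x) := by
      intro x hx
      have := h2 x hx
      simp only [f, dif_pos this]
      exact this.choose_spec
    have him : B ⊆ f '' A := by
      intro y hy
      obtain ⟨x, hx⟩ := h3 y hy
      have hxA := (h1 _ _ hx).1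
      refine ⟨x, hxA, ?_⟩
      have := (h4 _ _ _ _ (hf x hxA) hx).2
      rw [dist_self, mul_zero] at this
      exact dist_le_zero.1 this
    have hl : LipschitzOnWith C.toNNReal f A := by
      apply LipschitzOnWith.of_dist_le_mul
      intro x hx y hy
      rw [Real.coe_toNNReal _ hC.le]
      exact (h4 _ _ _ _ (hf x hx) (hf y hy)).2
    exact (dimH_mono him).trans hl.dimH_image_le
  · have : B = ∅ := by
      ext y
      exact (hB ⟨y⟩).elim
    rw [this]
    simp

theorem BE.dimH_eq {A : Set X} {B : Set Y} (h : BE A B) : dimH A = dimH B :=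
  le_antisymm h.symm.dimH_le h.dimH_le

theorem BE.sets {A : Set X} {B : Set Y} (h : BE A B) : ∃ f : A → B, Function.Bijective f ∧
    ∃ C : ℝ, 1 ≤ C ∧ ∀ x y : A,
    C⁻¹ * dist x y ≤ dist (f x) (f y) ∧ dist (f x) (f y) ≤ C * dist x y := by
  obtain ⟨H, C, hC, h1, h2, h3, h4⟩ := h
  choose f hf using fun x : A => h2 x x.2
  refine ⟨fun x => ⟨f x, (h1 _ _ (hf x)).2⟩, ⟨?_, ?_⟩, max C 1, le_max_right _ _, ?_⟩
  · intro x y hxy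
    have hxy : f x = f y := congrArg Subtype.val hxy
    have := (h4 _ _ _ _ (hf x) (hf y)).1
    rw [hxy, dist_self, mul_zero] at this
    exact Subtype.ext (dist_le_zero.1 this)
  · rintro ⟨y, hy⟩
    obtain ⟨x, hx⟩ := h3 y hy
    refine ⟨⟨x, (h1 _ _ hx).1⟩, Subtype.ext ?_⟩
    have := (h4 _ _ _ _ (hf ⟨x, (h1 _ _ hx).1⟩) hx).2
    simp only [dist_self, mul_zero] at this
    exact dist_le_zero.1 this
  · intro x y
    obtain ⟨u1, u2⟩ := h4 _ _ _ _ (hf x) (hf y)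
    have hp : 0 < max C 1 := by positivity
    constructor
    · rw [inv_mul_le_iff₀ hp]
      refine u1.trans ?_
      gcongr
      · exact le_max_left _ _
      · exact le_rfl
    · refine u2.trans ?_
      gcongr
      · exact le_max_left _ _
      · exact le_rfl

theorem BE.of_sets {A : Set X} {B : Set Y} (h : ∃ f : A → B, Function.Bijective f ∧
    ∃ C : ℝ, 1 ≤ C ∧ ∀ x y : A,
    C⁻¹ * dist x y ≤ dist (f x) (f y) ∧ dist (f x) (f y) ≤ C * dist x y) : BE A B := by
  obtain ⟨f, hf, C, hC, h⟩ := h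
  have hp : 0 < C := by positivity
  refine ⟨fun x y => ∃ hx : x ∈ A, (f ⟨x, hx⟩ : Y) = y, C, by positivity, ?_, ?_, ?_, ?_⟩
  · rintro x y ⟨hx, rfl⟩
    exact ⟨hx, Subtype.coe_prop _⟩
  · intro x hx
    exact ⟨_, hx, rfl⟩
  · intro y hy
    obtain ⟨x, hx⟩ := hf.2 ⟨y, hy⟩
    exact ⟨x, x.2, by simp [hx]⟩
  · rintro x y x' y' ⟨hx, rfl⟩ ⟨hx', rfl⟩
    obtain ⟨u1, u2⟩ := h ⟨x, hx⟩ ⟨x', hx'⟩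
    rw [inv_mul_le_iff₀ hp] at u1
    exact ⟨u1, u2⟩

end be

structure GDL (X : Type*) [MetricSpace X] (T : Type) (Ed : T → Type)
    (tgt : ∀ t, Ed t → T) (ρ : ℝ) where
  E : T → Set X
  L : T → Set X
  S : ∀ t, Ed t → X → X
  union : ∀ t, E t = L t ∪ ⋃ e, S t e '' E (tgt t e)
  compE : ∀ t, IsCompact (E t)
  compL : ∀ t, IsCompact (L t)
  nonE : ∀ t, (E t).Nonempty
  sim : ∀ t e, ∀ x ∈ E (tgt t e), ∀ y ∈ E (tgt t e), dist (S t e x) (S t e y) = ρ * dist x y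
  disjL : ∀ t e, Disjoint (L t) (S t e '' E (tgt t e))
  disj : ∀ t e e', e ≠ e' → Disjoint (S t e '' E (tgt t e)) (S t e' '' E (tgt t e'))

section gdl
variable {X Y : Type*} [MetricSpace X] [MetricSpace Y] {T : Type} [Finite T] {Ed : T → Type}
  [∀ t, Finite (Ed t)] {tgt : ∀ t, Ed t → T} {ρ : ℝ}

theorem GDL.contOn (G : GDL X T Ed tgt ρ) (hρ : 0 < ρ) (t e) :
    ContinuousOn (G.S t e) (G.E (tgt t e)) := by
  have : LipschitzOnWith ρ.toNNReal (G.S t e) (G.E (tgt t e)) := by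
    apply LipschitzOnWith.of_dist_le_mul
    intro x hx y hy
    rw [Real.coe_toNNReal _ hρ.le, G.sim t e x hx y hy]
  exact this.continuousOn

theorem GDL.sep (G : GDL X T Ed tgt ρ) (hρ : 0 < ρ) : ∃ δ, 0 < δ ∧
    (∀ t e, ∀ x ∈ G.L t, ∀ y ∈ G.S t e '' G.E (tgt t e), δ ≤ dist x y) ∧
    (∀ t e e', e ≠ e' → ∀ x ∈ G.S t e '' G.E (tgt t e), ∀ y ∈ G.S t e' '' G.E (tgt t e'),
      δ ≤ dist x y) := by
  have hc : ∀ t e, IsCompact (G.S t e '' G.E (tgt t e)) := fun t e =>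
    (G.compE _).image_of_continuousOn (G.contOn hρ t e)
  obtain ⟨a, ha, h1⟩ := finite_min (ι := Σ t, Ed t)
    (fun i a => ∀ x ∈ G.L i.1, ∀ y ∈ G.S i.1 i.2 '' G.E (tgt i.1 i.2), a ≤ dist x y)
    (fun i a b _ hba h x hx y hy => hba.trans (h x hx y hy))
    (fun i => compact_sep (G.compL _) (hc _ _) (G.disjL _ _))
  obtain ⟨b, hb, h2⟩ := finite_min (ι := Σ t, Ed t × Ed t)
    (fun i a => i.2.1 ≠ i.2.2 → ∀ x ∈ G.S i.1 i.2.1 '' G.E (tgt i.1 i.2.1),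
      ∀ y ∈ G.S i.1 i.2.2 '' G.E (tgt i.1 i.2.2), a ≤ dist x y)
    (fun i a b _ hba h hne x hx y hy => hba.trans (h hne x hx y hy))
    (fun i => by
      by_cases hne : i.2.1 = i.2.2
      · exact ⟨1, one_pos, fun h => (h hne).elim⟩
      · obtain ⟨δ, h, h'⟩ := compact_sep (hc _ _) (hc _ _) (G.disj i.1 _ _ hne)
        exact ⟨δ, h, fun _ => h'⟩)
  refine ⟨min a b, lt_min ha hb, fun t e x hx y hy => ?_, fun t e e' hne x hx y hy => ?_⟩
  · exact (min_le_left _ _).trans (h1 ⟨t, e⟩ x hx y hy)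
  · exact (min_le_right _ _).trans (h2 ⟨t, e, e'⟩ hne x hx y hy)

theorem GDL.bdd (G : GDL X T Ed tgt ρ) : ∃ D, 0 < D ∧
    ∀ t, ∀ x ∈ G.E t, ∀ y ∈ G.E t, dist x y ≤ D :=
  finite_max _ (fun _ _ _ _ hab h x hx y hy => (h x hx y hy).trans hab)
    (fun t => compact_bdd (G.compE t))

def Rel (G : GDL X T Ed tgt ρ) (G' : GDL Y T Ed tgt ρ) (H : T → X → Y → Prop) :
    ℕ → T → X → Y → Prop
  | 0, t, x, y => x ∈ G.E t ∧ y ∈ G'.E t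
  | n + 1, t, x, y => H t x y ∨ ∃ e, ∃ x' ∈ G.E (tgt t e), ∃ y' ∈ G'.E (tgt t e),
      x = G.S t e x' ∧ y = G'.S t e y' ∧ Rel G G' H n (tgt t e) x' y'

variable {G : GDL X T Ed tgt ρ} {G' : GDL Y T Ed tgt ρ} {H : T → X → Y → Prop}

theorem rel_swap (n : ℕ) (t : T) (x : X) (y : Y) :
    Rel G G' H n t x y ↔ Rel G' G (fun t y x => H t x y) n t y x := by
  induction n generalizing t x y with
  | zero => simp [Rel, and_comm]
  | succ n ih =>
    simp only [Rel]
    constructor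
    · rintro (h | ⟨e, x', hx', y', hy', h1, h2, h3⟩)
      · exact Or.inl h
      · exact Or.inr ⟨e, y', hy', x', hx', h2, h1, (ih _ _ _).1 h3⟩
    · rintro (h | ⟨e, x', hx', y', hy', h1, h2, h3⟩)
      · exact Or.inl h
      · exact Or.inr ⟨e, y', hy', x', hx', h2, h1, (ih _ _ _).2 h3⟩

theorem rel_mem (hH : ∀ t x y, H t x y → x ∈ G.L t ∧ y ∈ G'.L t) (n : ℕ) (t : T) (x : X) (y : Y)
    (h : Rel G G' H n t x y) : x ∈ G.E t ∧ y ∈ G'.E t := by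
  cases n with
  | zero => exact h
  | succ n =>
    rw [G.union, G'.union]
    rcases h with h | ⟨e, x', hx', y', hy', h1, h2, h3⟩
    · exact ⟨Or.inl (hH _ _ _ h).1, Or.inl (hH _ _ _ h).2⟩
    · exact ⟨Or.inr (Set.mem_iUnion.2 ⟨e, x', hx', h1.symm⟩),
        Or.inr (Set.mem_iUnion.2 ⟨e, y', hy', h2.symm⟩)⟩

theorem rel_anti (hH : ∀ t x y, H t x y → x ∈ G.L t ∧ y ∈ G'.L t) (n : ℕ) (t : T) (x : X) (y : Y)
    (h : Rel G G' H (n + 1) t x y) : Rel G G' H n t x y := by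
  induction n generalizing t x y with
  | zero => exact rel_mem hH _ _ _ _ h
  | succ n ih =>
    rcases h with h | ⟨e, x', hx', y', hy', h1, h2, h3⟩
    · exact Or.inl h
    · exact Or.inr ⟨e, x', hx', y', hy', h1, h2, ih _ _ _ h3⟩

theorem rel_bound (hρ : 0 < ρ) (hρ1 : ρ < 1)
    (hH : ∀ t x y, H t x y → x ∈ G.L t ∧ y ∈ G'.L t)
    {C : ℝ} (hC : 0 < C)
    (hb : ∀ t x y x' y', H t x y → H t x' y' → dist x x' ≤ C * dist y y') :
    ∃ C', 0 < C' ∧ ∀ t x y x' y', (∀ n, Rel G G' H n t x y) → (∀ n, Rel G G' H n t x' y') →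
      dist x x' ≤ C' * dist y y' := by
  obtain ⟨D, hD, hDb⟩ := G.bdd
  obtain ⟨δ, hδ, hs1, hs2⟩ := G'.sep hρ
  have hpos : 0 < D / δ := by positivity
  have key : ∀ n t x y x' y', Rel G G' H n t x y → Rel G G' H n t x' y' →
      dist x x' ≤ (C + D / δ) * dist y y' + D * ρ ^ n := by
    intro n
    induction n with
    | zero =>
      intro t x y x' y' h h'
      have := hDb t x h.1 x' h'.1
      have : 0 ≤ (C + D / δ) * dist y y' := by positivity
      simp; linarith
    | succ n ih =>
      intro t x y x' y' h h'
      have m1 := rel_mem hH _ _ _ _ h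
      have m2 := rel_mem hH _ _ _ _ h'
      have hp : 0 ≤ D * ρ ^ (n+1) := by positivity
      have big : δ ≤ dist y y' → dist x x' ≤ (C + D / δ) * dist y y' + D * ρ ^ (n+1) := by
        intro hd
        have h1 := hDb t x m1.1 x' m2.1
        have h2 : D = D / δ * δ := by field_simp
        have h3 : D / δ * δ ≤ D / δ * dist y y' := by gcongr
        have h4 : 0 ≤ C * dist y y' := by positivity
        linarith
      rcases h with h | ⟨e, x1, hx1, y1, hy1, rfl, rfl, h3⟩
      · rcases h' with h' | ⟨e', x1', hx1', y1', hy1', rfl, rfl, h3'⟩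
        · have := hb _ _ _ _ _ h h'
          have h4 : 0 ≤ D / δ * dist y y' := by positivity
          linarith
        · exact big (hs1 t e' _ (hH _ _ _ h).2 _ ⟨_, hy1', rfl⟩)
      · rcases h' with h' | ⟨e', x1', hx1', y1', hy1', rfl, rfl, h3'⟩
        · apply big
          rw [dist_comm]
          exact (hs1 t e _ (hH _ _ _ h').2 _ ⟨_, hy1, rfl⟩)
        · by_cases he : e = e'
          · subst he
            rw [G.sim t e _ hx1 _ hx1', G'.sim t e _ hy1 _ hy1']
            have := mul_le_mul_of_nonneg_left (ih _ _ _ _ _ h3 h3') hρ.le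
            calc _ ≤ _ := this
              _ = _ := by ring
          · exact big (hs2 t e e' he _ ⟨_, hy1, rfl⟩ _ ⟨_, hy1', rfl⟩)
  refine ⟨C + D / δ, by positivity, fun t x y x' y' h h' => ?_⟩
  have hl : Filter.Tendsto (fun n : ℕ => (C + D / δ) * dist y y' + D * ρ ^ n) Filter.atTop
      (nhds ((C + D / δ) * dist y y' + D * 0)) :=
    ((tendsto_pow_atTop_nhds_zero_of_lt_one hρ.le hρ1).const_mul D).const_add _
  rw [mul_zero, add_zero] at hl
  exact ge_of_tendsto' hl (fun n => key n t x y x' y' (h n) (h' n))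

theorem rel_total (hρ : 0 < ρ)
    (hH : ∀ t x y, H t x y → x ∈ G.L t ∧ y ∈ G'.L t)
    {C : ℝ} (hb : ∀ t x y x' y', H t x y → H t x' y' → dist y y' ≤ C * dist x x')
    (ht : ∀ t, ∀ x ∈ G.L t, ∃ y, H t x y) (t : T) (x : X) (hx : x ∈ G.E t) :
    ∃ y, ∀ n, Rel G G' H n t x y := by
  have hne : ∀ n t, ∀ x ∈ G.E t, ∃ y, Rel G G' H n t x y := by
    intro n
    induction n with
    | zero =>
      intro t x hx
      obtain ⟨y, hy⟩ := G'.nonE t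
      exact ⟨y, hx, hy⟩
    | succ n ih =>
      intro t x hx
      rw [G.union] at hx
      rcases hx with hx | hx
      · obtain ⟨y, hy⟩ := ht t x hx
        exact ⟨y, Or.inl hy⟩
      · obtain ⟨e, x', hx', rfl⟩ := Set.mem_iUnion.1 hx
        obtain ⟨y, hy⟩ := ih _ _ hx'
        exact ⟨_, Or.inr ⟨e, x', hx', y, (rel_mem hH _ _ _ _ hy).2, rfl, rfl, hy⟩⟩
  have hcomp : ∀ n t x, IsCompact {y | Rel G G' H n t x y} := by
    intro n
    induction n with
    | zero =>
      intro t x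
      by_cases hx : x ∈ G.E t
      · simpa [Rel, hx] using G'.compE t
      · simp [Rel, hx]
    | succ n ih =>
      intro t x
      have : {y | Rel G G' H (n+1) t x y} = {y | H t x y} ∪ ⋃ e, G'.S t e ''
          {y' | ∃ x' ∈ G.E (tgt t e), x = G.S t e x' ∧ Rel G G' H n (tgt t e) x' y'} := by
        ext y
        simp only [Rel, Set.mem_setOf_eq, Set.mem_union, Set.mem_iUnion, Set.mem_image]
        constructor
        · rintro (h | ⟨e, x', hx', y', hy', h1, h2, h3⟩)
          · exact Or.inl h
          · exact Or.inr ⟨e, y', ⟨x', hx', h1, h3⟩, h2.symm⟩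
        · rintro (h | ⟨e, y', ⟨x', hx', h1, h3⟩, h2⟩)
          · exact Or.inl h
          · exact Or.inr ⟨e, x', hx', y', (rel_mem hH _ _ _ _ h3).2, h1, h2.symm, h3⟩
      rw [this]
      refine IsCompact.union ?_ (isCompact_iUnion fun e => ?_)
      · apply Set.Subsingleton.isCompact
        intro y hy y' hy'
        have := hb _ _ _ _ _ hy hy'
        rw [dist_self, mul_zero] at this
        exact dist_le_zero.1 this
      · apply IsCompact.image_of_continuousOn
        · by_cases hx : ∃ x' ∈ G.E (tgt t e), x = G.S t e x'
          · obtain ⟨x', hx', rfl⟩ := hx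
            convert ih (tgt t e) x' using 1
            ext y'
            simp only [Set.mem_setOf_eq]
            constructor
            · rintro ⟨x2, hx2, h1, h2⟩
              have := G.sim t e _ hx' _ hx2
              rw [h1, dist_self] at this
              have : dist x' x2 = 0 := by
                rcases mul_eq_zero.1 this.symm with h | h
                · exact (hρ.ne' h).elim
                · exact h
              rw [dist_eq_zero] at this
              rwa [this]
            · intro h
              exact ⟨x', hx', rfl, h⟩
          · convert isCompact_empty
            ext y'
            simp only [Set.mem_setOf_eq, Set.mem_empty_iff_false, iff_false]
            rintro ⟨x2, hx2, h1, h2⟩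
            exact hx ⟨x2, hx2, h1⟩
        · apply (G'.contOn hρ t e).mono
          rintro y' ⟨x', hx', h1, h2⟩
          exact (rel_mem hH _ _ _ _ h2).2
  obtain ⟨y, hy⟩ := IsCompact.nonempty_iInter_of_sequence_nonempty_isCompact_isClosed
    (fun n => {y | Rel G G' H n t x y}) (fun n y hy => rel_anti hH n t x y hy)
    (fun n => hne n t x hx) (hcomp 0 t x) (fun n => (hcomp n t x).isClosed)
  exact ⟨y, fun n => Set.mem_iInter.1 hy n⟩

theorem lemmaA (hρ : 0 < ρ) (hρ1 : ρ < 1) (G : GDL X T Ed tgt ρ) (G' : GDL Y T Ed tgt ρ)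
    (h : ∀ t, BE (G.L t) (G'.L t)) (t : T) : BE (G.E t) (G'.E t) := by
  choose H C0 hC0 h1 h2 h3 h4 using h
  obtain ⟨C, hC, h4⟩ := finite_max (fun t C => ∀ x y x' y', H t x y → H t x' y' →
      dist x x' ≤ C * dist y y' ∧ dist y y' ≤ C * dist x x')
    (by
      intro t a b ha hab h x y x' y' p q
      obtain ⟨u, w⟩ := h x y x' y' p q
      constructor
      · exact u.trans (by gcongr)
      · exact w.trans (by gcongr)) (fun t => ⟨C0 t, hC0 t, h4 t⟩)
  have h1' : ∀ t y x, H t x y → y ∈ G'.L t ∧ x ∈ G.L t := fun t y x h => (h1 t x y h).symm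
  obtain ⟨C1, hC1, hb1⟩ := rel_bound hρ hρ1 h1 hC (fun t x y x' y' p q => (h4 t x y x' y' p q).1)
  obtain ⟨C2, hC2, hb2⟩ := rel_bound (G := G') (G' := G) (H := fun t y x => H t x y) hρ hρ1
    h1' hC (fun t y x y' x' p q => (h4 t x y x' y' p q).2)
  refine ⟨fun x y => ∀ n, Rel G G' H n t x y, C1 + C2, by positivity, ?_, ?_, ?_, ?_⟩
  · intro x y h
    exact h 0
  · exact rel_total hρ h1 (fun t x y x' y' p q => (h4 t x y x' y' p q).2) h2 t
  · intro y hy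
    obtain ⟨x, hx⟩ := rel_total (G := G') (G' := G) (H := fun t y x => H t x y) hρ h1'
      (fun t y x y' x' p q => (h4 t x y x' y' p q).1) h3 t y hy
    exact ⟨x, fun n => (rel_swap n t x y).2 (hx n)⟩
  · intro x y x' y' p q
    have u1 := hb1 t x y x' y' p q
    have u2 := hb2 t y x y' x' (fun n => (rel_swap n t x y).1 (p n))
      (fun n => (rel_swap n t x' y').1 (q n))
    constructor
    · refine u1.trans ?_
      gcongr
      linarith
    · refine u2.trans ?_
      gcongr
      linarith

end gdl
end GDP



namespace GDP

def Seq (_ρ : Set.Ioo (0:ℝ) 1) : Type := ℕ → ℕ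

section seq
variable {ρ : Set.Ioo (0:ℝ) 1}

noncomputable def sdist (x y : Seq ρ) : ℝ :=
  if x = y then 0 else (ρ : ℝ) ^ (PiNat.firstDiff (E := fun _ => ℕ) x y)

theorem sdist_nonneg (x y : Seq ρ) : 0 ≤ sdist x y := by
  have := ρ.2.1
  unfold sdist
  split_ifs
  · exact le_rfl
  · positivity

theorem sdist_tri (x y z : Seq ρ) : sdist x z ≤ max (sdist x y) (sdist y z) := by
  by_cases hxz : x = z
  · subst hxz
    exact le_trans (by simp [sdist]) (le_max_of_le_left (sdist_nonneg _ _))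
  by_cases hxy : x = y
  · subst hxy
    exact le_max_right _ _
  by_cases hyz : y = z
  · subst hyz
    exact le_max_left _ _
  have h := PiNat.min_firstDiff_le (E := fun _ => ℕ) x y z hxz
  simp only [sdist, hxz, hxy, hyz, if_false]
  rcases min_le_iff.1 h with h | h
  · exact le_max_of_le_left (pow_le_pow_of_le_one ρ.2.1.le ρ.2.2.le h)
  · exact le_max_of_le_right (pow_le_pow_of_le_one ρ.2.1.le ρ.2.2.le h)

noncomputable instance : MetricSpace (Seq ρ) where
  dist := sdist
  dist_self x := by simp [sdist]
  dist_comm x y := by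
    unfold sdist
    have h : PiNat.firstDiff (E := fun _ => ℕ) x y = PiNat.firstDiff (E := fun _ => ℕ) y x :=
      PiNat.firstDiff_comm _ _
    by_cases hxy : x = y
    · rw [hxy]
    · rw [if_neg hxy, if_neg (Ne.symm hxy)]
      exact congrArg _ h
  dist_triangle x y z := (sdist_tri x y z).trans
    (max_le_add_of_nonneg (sdist_nonneg _ _) (sdist_nonneg _ _))
  eq_of_dist_eq_zero := by
    intro x y h
    by_contra hne
    change sdist x y = 0 at h
    simp only [sdist, hne, if_false] at h
    exact (pow_pos ρ.2.1 _).ne' h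

theorem seq_dist (x y : Seq ρ) : dist x y = sdist x y := rfl

theorem seq_dist_le (x y : Seq ρ) (n : ℕ) (h : ∀ i < n, x i = y i) : dist x y ≤ (ρ:ℝ) ^ n := by
  rw [seq_dist]
  unfold sdist
  split_ifs with hxy
  · exact pow_nonneg ρ.2.1.le _
  · apply pow_le_pow_of_le_one ρ.2.1.le ρ.2.2.le
    by_contra! hlt
    exact PiNat.apply_firstDiff_ne (E := fun _ => ℕ) hxy (h _ hlt)

theorem seq_dist_eq (x y : Seq ρ) (n : ℕ) (h : ∀ i < n, x i = y i) (hn : x n ≠ y n) :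
    dist x y = (ρ:ℝ) ^ n := by
  rw [seq_dist]
  unfold sdist
  have hxy : x ≠ y := fun h => hn (by rw [h])
  rw [if_neg hxy]
  congr 1
  apply le_antisymm
  · by_contra! hlt
    exact hn (PiNat.apply_eq_of_lt_firstDiff (E := fun _ => ℕ) hlt)
  · by_contra! hlt
    exact PiNat.apply_firstDiff_ne (E := fun _ => ℕ) hxy (h _ hlt)

theorem seq_first (x y : Seq ρ) (h : x ≠ y) : ∃ n, (∀ i < n, x i = y i) ∧ x n ≠ y n :=
  ⟨PiNat.firstDiff (E := fun _ => ℕ) x y,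
    fun _ hi => PiNat.apply_eq_of_lt_firstDiff (E := fun _ => ℕ) hi,
    PiNat.apply_firstDiff_ne (E := fun _ => ℕ) h⟩

def cons (a : ℕ) (x : Seq ρ) : Seq ρ := fun n => Nat.casesOn n a (fun k => x k)
def tl (x : Seq ρ) : Seq ρ := fun n => x (n + 1)

@[simp] theorem cons_zero (a : ℕ) (x : Seq ρ) : cons a x 0 = a := rfl
@[simp] theorem cons_succ (a n : ℕ) (x : Seq ρ) : cons a x (n+1) = x n := rfl
@[simp] theorem tl_apply (n : ℕ) (x : Seq ρ) : tl x n = x (n+1) := rfl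
@[simp] theorem tl_cons (a : ℕ) (x : Seq ρ) : tl (cons a x) = x := rfl
theorem cons_tl (x : Seq ρ) : cons (x 0) (tl x) = x := by
  funext n
  cases n <;> rfl
theorem cons_tl' {a : ℕ} (x : Seq ρ) (h : x 0 = a) : cons a (tl x) = x := by
  subst h
  exact cons_tl x

theorem dist_of_ne (x y : Seq ρ) (h : x 0 ≠ y 0) : dist x y = 1 := by
  rw [seq_dist_eq x y 0 (by simp) h, pow_zero]

theorem dist_of_eq (x y : Seq ρ) (h : x 0 = y 0) : dist x y = ρ * dist (tl x) (tl y) := by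
  by_cases hxy : tl x = tl y
  · have : x = y := by rw [← cons_tl x, ← cons_tl y, h, hxy]
    rw [this]
    simp
  · obtain ⟨n, h1, h2⟩ := seq_first _ _ hxy
    rw [seq_dist_eq _ _ n h1 h2, seq_dist_eq x y (n+1) _ h2, pow_succ']
    intro i hi
    cases i with
    | zero => exact h
    | succ i => exact h1 i (by omega)

theorem dist_cons (a : ℕ) (x y : Seq ρ) : dist (cons a x) (cons a y) = ρ * dist x y :=
  dist_of_eq _ _ rfl

theorem dist_cons_ne {a b : ℕ} (h : a ≠ b) (x y : Seq ρ) : dist (cons a x) (cons b y) = 1 :=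
  dist_of_ne _ _ h

def Sig (ρ : Set.Ioo (0:ℝ) 1) (M : ℕ) : Set (Seq ρ) := {x | ∀ n, x n < M}

theorem sig_compact (M : ℕ) : IsCompact (Sig ρ M) := by
  have h1 : IsCompact (Set.univ.pi (fun _ : ℕ => Set.Iio M)) :=
    isCompact_univ_pi (fun _ => (Set.finite_Iio M).isCompact)
  let f : (ℕ → ℕ) → Seq ρ := fun x => x
  have hf : Continuous f := by
    rw [continuous_iff_continuousAt]
    intro x
    rw [ContinuousAt, Metric.tendsto_nhds]
    intro ε hε
    obtain ⟨n, hn⟩ := exists_pow_lt_of_lt_one hε ρ.2.2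
    have : {y : ℕ → ℕ | ∀ i < n, y i = x i} ∈ nhds x := by
      apply IsOpen.mem_nhds
      · have := PiNat.isOpen_cylinder (fun _ : ℕ => ℕ) x n
        exact this
      · intro i _
        rfl
    filter_upwards [this] with y hy
    exact (seq_dist_le (f y) (f x) n hy).trans_lt hn
  have h2 := h1.image hf
  convert h2 using 1
  ext x
  constructor
  · intro h
    exact ⟨x, fun i _ => h i, rfl⟩
  · rintro ⟨y, hy, rfl⟩ i
    exact hy i (Set.mem_univ _)

theorem cons_image_compact {A : Set (Seq ρ)} (a : ℕ) (h : IsCompact A) :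
    IsCompact (cons a '' A) := by
  apply h.image
  have : LipschitzWith 1 (cons a : Seq ρ → Seq ρ) := by
    apply LipschitzWith.of_dist_le_mul
    intro x y
    rw [dist_cons]
    have := ρ.2.2
    simp only [NNReal.coe_one]
    gcongr
  exact this.continuous

theorem mem_cons_sig {M a : ℕ} {x : Seq ρ} : x ∈ cons a '' Sig ρ M ↔ x 0 = a ∧ ∀ n, x (n+1) < M := by
  constructor
  · rintro ⟨y, hy, rfl⟩
    exact ⟨rfl, fun n => hy n⟩
  · rintro ⟨rfl, h⟩
    exact ⟨tl x, h, cons_tl x⟩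

/-- `q` copies of the symbolic space -/
def FF (ρ : Set.Ioo (0:ℝ) 1) (M q : ℕ) : Set (Seq ρ) := {x | x 0 < q ∧ ∀ n, x (n+1) < M}

theorem ff_eq (M q : ℕ) : FF ρ M q = ⋃ c : Fin q, cons (c : ℕ) '' Sig ρ M := by
  ext x
  simp only [Set.mem_iUnion, mem_cons_sig]
  constructor
  · rintro ⟨h1, h2⟩
    exact ⟨⟨x 0, h1⟩, rfl, h2⟩
  · rintro ⟨c, h1, h2⟩
    exact ⟨h1 ▸ c.2, h2⟩

theorem ff_compact (M q : ℕ) : IsCompact (FF ρ M q) := by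
  rw [ff_eq]
  exact isCompact_iUnion fun c => cons_image_compact _ (sig_compact M)

theorem zero_mem_sig {M : ℕ} (hM : 0 < M) : (fun _ => 0 : Seq ρ) ∈ Sig ρ M := fun _ => hM

theorem zero_mem_ff {M q : ℕ} (hM : 0 < M) (hq : 0 < q) : (fun _ => 0 : Seq ρ) ∈ FF ρ M q :=
  ⟨hq, fun _ => hM⟩

/-- Hilbert's hotel. -/
theorem hilbert {M : ℕ} (hM : 2 ≤ M) : BE (FF ρ M 2) (Sig ρ M) := by
  let G : GDL (Seq ρ) Unit (fun _ => Unit) (fun _ _ => ()) (ρ : ℝ) :=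
    { E := fun _ => FF ρ M 2
      L := fun _ => cons 1 '' Sig ρ M ∪
        ⋃ a : Fin (M - 2), cons 0 '' (cons ((a : ℕ) + 2) '' Sig ρ M)
      S := fun _ _ => cons 0
      union := by
        rintro -
        ext x
        simp only [Set.mem_union, mem_cons_sig, Set.mem_iUnion]
        constructor
        · rintro ⟨h1, h2⟩
          by_cases h0 : x 0 = 1
          · exact Or.inl (Or.inl ⟨h0, h2⟩)
          have h0 : x 0 = 0 := by omega
          by_cases h3 : x 1 < 2
          · exact Or.inr ⟨(), tl x, ⟨h3, fun n => h2 (n+1)⟩, cons_tl' x h0⟩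
          · refine Or.inl (Or.inr ⟨⟨x 1 - 2, by have := h2 0; simp at this; omega⟩, tl x, ?_, cons_tl' x h0⟩)
            rw [mem_cons_sig]
            refine ⟨?_, fun n => h2 (n+1)⟩
            show x 1 = (x 1 - 2) + 2
            omega
        · rintro ((⟨h1, h2⟩ | ⟨a, y, hy, rfl⟩) | ⟨-, y, hy, rfl⟩)
          · exact ⟨by omega, h2⟩
          · rw [mem_cons_sig] at hy
            refine ⟨by simp, fun n => ?_⟩
            rw [cons_succ]
            cases n with
            | zero => rw [hy.1]; omega
            | succ n => exact hy.2 n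
          · refine ⟨by simp, fun n => ?_⟩
            rw [cons_succ]
            cases n with
            | zero => exact lt_of_lt_of_le hy.1 hM
            | succ n => exact hy.2 n
      compE := fun _ => ff_compact _ _
      compL := fun _ => (cons_image_compact _ (sig_compact M)).union
        (isCompact_iUnion fun c => cons_image_compact _ (cons_image_compact _ (sig_compact M)))
      nonE := fun _ => ⟨_, zero_mem_ff (by omega) (by omega)⟩
      sim := fun _ _ x _ y _ => dist_cons _ _ _
      disjL := by
        rintro - -
        rw [Set.disjoint_left]
        rintro x hx ⟨y, hy, rfl⟩
        simp only [Set.mem_union, mem_cons_sig, Set.mem_iUnion] at hx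
        rcases hx with hx | ⟨a, z, hz, hzy⟩
        · simp at hx
        · have : z = y := congrArg tl hzy
          subst this
          rw [mem_cons_sig] at hz
          have := hz.1
          have := hy.1
          omega
      disj := fun _ e e' h => (h rfl).elim }
  let G' : GDL (Seq ρ) Unit (fun _ => Unit) (fun _ _ => ()) (ρ : ℝ) :=
    { E := fun _ => Sig ρ M
      L := fun _ => ⋃ a : Fin (M - 1), cons ((a : ℕ) + 1) '' Sig ρ M
      S := fun _ _ => cons 0
      union := by
        rintro -
        ext x
        simp only [Set.mem_union, mem_cons_sig, Set.mem_iUnion]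
        constructor
        · intro h
          by_cases h0 : x 0 = 0
          · exact Or.inr ⟨(), h0, fun n => h _⟩
          · exact Or.inl ⟨⟨x 0 - 1, by have := h 0; omega⟩, by simp; omega, fun n => h _⟩
        · rintro (⟨a, h1, h2⟩ | ⟨-, h1, h2⟩) n
          · cases n with
            | zero => omega
            | succ n => exact h2 n
          · cases n with
            | zero => omega
            | succ n => exact h2 n
      compE := fun _ => sig_compact _
      compL := fun _ => isCompact_iUnion fun c => cons_image_compact _ (sig_compact M)
      nonE := fun _ => ⟨_, zero_mem_sig (by omega)⟩
      sim := fun _ _ x _ y _ => dist_cons _ _ _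
      disjL := by
        rintro - -
        rw [Set.disjoint_left]
        rintro x hx hx'
        simp only [mem_cons_sig, Set.mem_iUnion] at hx hx'
        obtain ⟨a, hx⟩ := hx
        omega
      disj := fun _ e e' h => (h rfl).elim }
  refine lemmaA ρ.2.1 ρ.2.2 G G' (fun t => ?_) ()
  have hρ := ρ.2.1
  have hρ1 := ρ.2.2
  refine ⟨fun x y => x ∈ G.L t ∧ ((x 0 = 1 ∧ y = x) ∨ (x 0 = 0 ∧ y = tl x)), (ρ:ℝ)⁻¹,
    by positivity, ?_, ?_, ?_, ?_⟩
  · rintro x y ⟨hx, h⟩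
    refine ⟨hx, ?_⟩
    simp only [G, Set.mem_union, mem_cons_sig, Set.mem_iUnion] at hx
    simp only [G', Set.mem_iUnion, mem_cons_sig]
    rcases hx with ⟨h1, h2⟩ | ⟨a, z, hz, rfl⟩
    · rcases h with ⟨h3, rfl⟩ | ⟨h3, -⟩
      · exact ⟨⟨0, by omega⟩, by simpa using h1, h2⟩
      · omega
    · rcases h with ⟨h3, rfl⟩ | ⟨h3, rfl⟩
      · simp at h3
      · rw [mem_cons_sig] at hz
        exact ⟨⟨a + 1, by omega⟩, by simp [hz.1], hz.2⟩
  · intro x hx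
    have hx' := hx
    simp only [G, Set.mem_union, mem_cons_sig, Set.mem_iUnion] at hx
    rcases hx with ⟨h1, h2⟩ | ⟨a, z, hz, rfl⟩
    · exact ⟨x, hx', Or.inl ⟨h1, rfl⟩⟩
    · exact ⟨z, hx', Or.inr ⟨rfl, rfl⟩⟩
  · intro y hy
    simp only [G', Set.mem_iUnion, mem_cons_sig] at hy
    obtain ⟨a, h1, h2⟩ := hy
    by_cases ha : (a : ℕ) = 0
    · refine ⟨y, ?_, Or.inl ⟨by omega, rfl⟩⟩
      simp only [G, Set.mem_union, mem_cons_sig, Set.mem_iUnion]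
      exact Or.inl ⟨by omega, h2⟩
    · refine ⟨cons 0 y, ?_, Or.inr ⟨rfl, rfl⟩⟩
      simp only [G, Set.mem_union, mem_cons_sig, Set.mem_iUnion]
      refine Or.inr ⟨⟨a - 1, by omega⟩, y, ?_, rfl⟩
      rw [mem_cons_sig]
      exact ⟨by simp; omega, h2⟩
  · have key : ∀ x y x' y' : Seq ρ, x' ∈ G.L t → x 0 = 1 → y = x → x' 0 = 0 → y' = tl x' →
        dist x x' = 1 ∧ dist y y' = 1 := by
      rintro x y x' y' hx' h1 rfl h3 rfl
      refine ⟨dist_of_ne _ _ (by omega), dist_of_ne _ _ ?_⟩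
      simp only [G, Set.mem_union, mem_cons_sig, Set.mem_iUnion] at hx'
      rcases hx' with hx' | ⟨a, z, hz, rfl⟩
      · omega
      · rw [mem_cons_sig] at hz
        rw [tl_cons, hz.1, h1]
        omega
    have hinv : 1 ≤ (ρ:ℝ)⁻¹ := (one_le_inv₀ hρ).2 hρ1.le
    rintro x y x' y' ⟨hx, h⟩ ⟨hx', h'⟩
    rcases h with ⟨h1, h2⟩ | ⟨h1, h2⟩ <;> rcases h' with ⟨h1', h2'⟩ | ⟨h1', h2'⟩
    · subst h2 h2'
      constructor <;> exact le_mul_of_one_le_left dist_nonneg hinv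
    · obtain ⟨e1, e2⟩ := key x y x' y' hx' h1 h2 h1' h2'
      rw [e1, e2]
      constructor <;> linarith
    · obtain ⟨e1, e2⟩ := key x' y' x y hx h1' h2' h1 h2
      rw [dist_comm x x', dist_comm y y', e1, e2]
      constructor <;> linarith
    · subst h2 h2'
      rw [dist_of_eq x x' (by omega)]
      constructor
      · gcongr
        linarith
      · rw [inv_mul_cancel_left₀ hρ.ne']

section good
variable {X : Type*} [MetricSpace X]

theorem good_union {M : ℕ} (hM : 2 ≤ M) {A B : Set X} (hA : BE A (Sig ρ M)) (hB : BE B (Sig ρ M))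
    (cA : IsCompact A) (cB : IsCompact B) (hd : Disjoint A B) : BE (A ∪ B) (Sig ρ M) := by
  have h : ∀ a, BE (Sig ρ M) (cons a '' Sig ρ M) := fun a =>
    BE.image ρ.2.1 (cons a) (fun x _ y _ => dist_cons a x y)
  have h1 := (hA.trans (h 0)).union (hB.trans (h 1)) cA cB (cons_image_compact _ (sig_compact M))
    (cons_image_compact _ (sig_compact M)) hd (by
      rw [Set.disjoint_left]
      intro x hx hx'
      rw [mem_cons_sig] at hx hx'
      omega)
  refine h1.trans ?_
  convert hilbert hM using 1
  rw [ff_eq]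
  ext x
  simp

theorem good_iUnion {M : ℕ} (hM : 2 ≤ M) {ι : Type*} [Finite ι] [Nonempty ι] {A : ι → Set X}
    (hA : ∀ i, BE (A i) (Sig ρ M)) (cA : ∀ i, IsCompact (A i))
    (hd : ∀ i j, i ≠ j → Disjoint (A i) (A j)) : BE (⋃ i, A i) (Sig ρ M) := by
  cases nonempty_fintype ι
  have key : ∀ s : Finset ι, s.Nonempty → BE (⋃ i ∈ s, A i) (Sig ρ M) := by
    intro s hs
    induction hs using Finset.Nonempty.cons_induction with
    | singleton a => simpa using hA a
    | cons a s ha hs ih =>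
      have : (⋃ i ∈ Finset.cons a s ha, A i) = A a ∪ ⋃ i ∈ s, A i := by
        ext x
        simp
      rw [this]
      refine good_union hM (hA a) ih (cA a) (s.isCompact_biUnion fun i _ => cA i) ?_
      simp only [Set.disjoint_iUnion_right]
      intro i hi
      apply hd
      rintro rfl
      exact ha hi
  simpa using key Finset.univ Finset.univ_nonempty

theorem good_ff {M q : ℕ} (hM : 2 ≤ M) (hq : 0 < q) : BE (FF ρ M q) (Sig ρ M) := by
  rw [ff_eq]
  have : Nonempty (Fin q) := ⟨⟨0, hq⟩⟩
  refine good_iUnion hM (fun c => (BE.image ρ.2.1 (cons _) (fun x _ y _ => dist_cons _ x y)).symm)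
    (fun c => cons_image_compact _ (sig_compact M)) ?_
  intro i j hij
  rw [Set.disjoint_left]
  intro x hx hx'
  rw [mem_cons_sig] at hx hx'
  exact hij (Fin.ext (hx.1.symm.trans hx'.1))
end good
end seq
end GDP



namespace GDP

structure GDS (X : Type*) [MetricSpace X] (T : Type) (ρ : ℝ) (K : T → Set X) where
  Ed : T → Type
  fin : ∀ t, Fintype (Ed t)
  tgt : ∀ t, Ed t → T
  S : ∀ t, Ed t → X → X
  sim : ∀ t e x y, dist (S t e x) (S t e y) = ρ * dist x y
  union : ∀ t, K t = ⋃ e, S t e '' K (tgt t e)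
  disj : ∀ t e e', e ≠ e' → Disjoint (S t e '' K (tgt t e)) (S t e' '' K (tgt t e'))

attribute [instance] GDS.fin

section gds
variable {X : Type*} [MetricSpace X] {T : Type} {K : T → Set X}

def GDS.Counts [Fintype T] {ρ : ℝ} (D : GDS X T ρ K) (A : Matrix T T ℕ) : Prop :=
  ∀ t (f : T → ℕ), ∑ e, f (D.tgt t e) = ∑ t', A t t' * f t'

def GDS.one : GDS X T (1:ℝ) K where
  Ed := fun _ => Unit
  fin := fun _ => inferInstance
  tgt := fun t _ => t
  S := fun _ _ x => x
  sim := by simp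
  union := by
    intro t
    rw [Set.iUnion_const]
    simp
  disj := fun _ e e' h => (h rfl).elim

theorem GDS.one_counts [Fintype T] : (GDS.one : GDS X T (1:ℝ) K).Counts 1 := by
  intro t f
  have : ∀ t', (1 : Matrix T T ℕ) t t' * f t' = if t = t' then f t' else 0 := by
    intro t'
    rw [Matrix.one_apply]
    split_ifs <;> simp
  simp only [this, Finset.sum_ite_eq, Finset.mem_univ, if_true]
  exact Fintype.sum_unique (ι := Unit) _

theorem GDS.S_inj {ρ : ℝ} (hρ : 0 < ρ) (D : GDS X T ρ K) (t e) : Function.Injective (D.S t e) := by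
  intro x y h
  have := D.sim t e x y
  rw [h, dist_self] at this
  exact dist_eq_zero.1 ((mul_eq_zero.1 this.symm).resolve_left hρ.ne')

def GDS.comp {ρ ρ' : ℝ} (hρ : 0 < ρ) (D : GDS X T ρ K) (D' : GDS X T ρ' K) :
    GDS X T (ρ * ρ') K where
  Ed := fun t => Σ e : D.Ed t, D'.Ed (D.tgt t e)
  fin := fun _ => inferInstance
  tgt := fun _ e => D'.tgt _ e.2
  S := fun t e x => D.S t e.1 (D'.S _ e.2 x)
  sim := by
    intro t e x y
    rw [D.sim, D'.sim, mul_assoc]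
  union := by
    intro t
    ext x
    rw [D.union t]
    simp only [Set.mem_iUnion]
    constructor
    · rintro ⟨e, y, hy, rfl⟩
      rw [D'.union] at hy
      simp only [Set.mem_iUnion] at hy
      obtain ⟨f, z, hz, rfl⟩ := hy
      exact ⟨⟨e, f⟩, z, hz, rfl⟩
    · rintro ⟨⟨e, f⟩, z, hz, rfl⟩
      refine ⟨e, _, ?_, rfl⟩
      rw [D'.union]
      exact Set.mem_iUnion.2 ⟨f, z, hz, rfl⟩
  disj := by
    rintro t ⟨e, f⟩ ⟨e', f'⟩ hne
    rw [Set.disjoint_left]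
    rintro _ ⟨z, hz, rfl⟩ ⟨z', hz', h⟩
    have m : D'.S _ f z ∈ K (D.tgt t e) := by
      rw [D'.union]
      exact Set.mem_iUnion.2 ⟨f, z, hz, rfl⟩
    have m' : D'.S _ f' z' ∈ K (D.tgt t e') := by
      rw [D'.union]
      exact Set.mem_iUnion.2 ⟨f', z', hz', rfl⟩
    by_cases hee : e = e'
    · subst hee
      have := D.S_inj hρ _ _ h
      have hff : f ≠ f' := by
        rintro rfl
        exact hne rfl
      exact Set.disjoint_left.1 (D'.disj _ f f' hff) ⟨z, hz, rfl⟩ ⟨z', hz', this⟩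
    · exact Set.disjoint_left.1 (D.disj _ e e' hee) ⟨_, m, rfl⟩ ⟨_, m', h⟩

theorem GDS.comp_counts [Fintype T] {ρ ρ' : ℝ} (hρ : 0 < ρ) {D : GDS X T ρ K} {D' : GDS X T ρ' K}
    {A B : Matrix T T ℕ} (h : D.Counts A) (h' : D'.Counts B) :
    (D.comp hρ D').Counts (A * B) := by
  intro t f
  have h1 : ∑ e, f ((D.comp hρ D').tgt t e) = ∑ e : D.Ed t, ∑ g, f (D'.tgt (D.tgt t e) g) :=
    Fintype.sum_sigma _
  rw [h1]
  simp only [h' _ f]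
  rw [h t (fun u => ∑ t', B u t' * f t')]
  simp only [Matrix.mul_apply, Finset.mul_sum, Finset.sum_mul]
  rw [Finset.sum_comm]
  simp only [mul_assoc]

theorem gds_pow [Fintype T] {r : ℝ} (hr : 0 < r) {A : Matrix T T ℕ} (D : GDS X T r K)
    (h : D.Counts A) (k : ℕ) : ∃ D' : GDS X T (r ^ k) K, D'.Counts (A ^ k) := by
  induction k with
  | zero =>
    rw [pow_zero, pow_zero]
    exact ⟨GDS.one, GDS.one_counts⟩
  | succ k ih =>
    obtain ⟨D', h'⟩ := ih
    rw [pow_succ', pow_succ']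
    exact ⟨D.comp hr D', GDS.comp_counts hr h h'⟩

theorem slot_exists {ι : Type*} [Fintype ι] (w : ι → ℕ) {n M : ℕ} (b : ι → Fin n)
    (h : ∀ β, ∑ i with b i = β, w i ≤ M) :
    ∃ d : (i : ι) → Fin (w i) → Fin M, ∀ i j (x : Fin (w i)) (y : Fin (w j)),
      b i = b j → d i x = d j y → (⟨i, x⟩ : Σ i, Fin (w i)) = ⟨j, y⟩ := by
  have key : ∀ β, Nonempty ((Σ i : {i // b i = β}, Fin (w i)) ↪ Fin M) := by
    intro β
    apply Function.Embedding.nonempty_of_card_le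
    rw [Fintype.card_sigma]
    simp only [Fintype.card_fin]
    refine le_trans (le_of_eq ?_) (h β)
    exact (Finset.sum_subtype (p := fun i => b i = β) _ (by simp) w).symm
  let F := fun β => Classical.choice (key β)
  refine ⟨fun i x => F (b i) ⟨⟨i, rfl⟩, x⟩, ?_⟩
  intro i j x y hb hd
  have gen : ∀ β (hi : b i = β) (hj : b j = β), F β ⟨⟨i, hi⟩, x⟩ = F β ⟨⟨j, hj⟩, y⟩ →
      (⟨i, x⟩ : Σ i, Fin (w i)) = ⟨j, y⟩ := by
    intro β hi hj he
    have h2 := (F β).injective he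
    have h3 := congrArg (fun s : (Σ i : {i // b i = β}, Fin (w i)) =>
      (⟨s.1.1, s.2⟩ : Σ i, Fin (w i))) h2
    exact h3
  have tr : ∀ β (hj : b j = β), β = b j → F β ⟨⟨j, hj⟩, y⟩ = F (b j) ⟨⟨j, rfl⟩, y⟩ := by
    rintro β hj rfl
    rfl
  apply gen (b i) rfl hb.symm
  rw [tr _ _ hb]
  exact hd

theorem lemmaM {ρ : Set.Ioo (0:ℝ) 1} [Finite T] (D : GDS X T (ρ:ℝ) K)
    (cK : ∀ t, IsCompact (K t)) (nK : ∀ t, (K t).Nonempty) (Act : T → Prop) (w : T → ℕ)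
    (hw : ∀ t, 0 < w t) {M : ℕ} (hM : 2 ≤ M)
    (b : ∀ t : {t // Act t}, {e : D.Ed t // Act (D.tgt t e)} → Fin (w t))
    (hsum : ∀ t β, ∑ e with b t e = β, w (D.tgt t e) ≤ M)
    (hgood : ∀ t, Act t → ∀ e, ¬ Act (D.tgt t e) → BE (K (D.tgt t e)) (Sig ρ M))
    (hleaf : ∀ t : {t // Act t}, (∃ e, ¬ Act (D.tgt t e)) ↔
      ∑ e : {e : D.Ed t // Act (D.tgt t e)}, w (D.tgt t e) < w t * M) (t : T) (ht : Act t) :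
    BE (K t) (Sig ρ M) := by
  have hρ := ρ.2.1
  have hρ1 := ρ.2.2
  choose d hd using fun t : {t // Act t} => slot_exists (fun e : {e : D.Ed t // Act (D.tgt t e)} => w (D.tgt t e))
    (b t) (hsum t)
  let slot : ∀ t : {t // Act t}, (Σ e : {e : D.Ed t // Act (D.tgt t e)}, Fin (w (D.tgt t e))) →
    Fin (w t) × Fin M := fun t s => (b t s.1, d t s.1 s.2)
  have slot_inj : ∀ t, Function.Injective (slot t) := by
    rintro t ⟨e, x⟩ ⟨e', x'⟩ h
    exact hd t e e' x x' (congrArg Prod.fst h) (congrArg Prod.snd h)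
  have slot_free : ∀ t : {t // Act t}, (∃ e, ¬ Act (D.tgt t e)) ↔ ∃ s, s ∉ Set.range (slot t) := by
    intro t
    rw [hleaf t]
    have hc : Fintype.card (Σ e : {e : D.Ed t // Act (D.tgt t e)}, Fin (w (D.tgt t e))) =
        ∑ e : {e : D.Ed t // Act (D.tgt t e)}, w (D.tgt t e) := by
      rw [Fintype.card_sigma]
      simp
    have hc' : Fintype.card (Fin (w t) × Fin M) = w t * M := by simp
    rw [← hc, ← hc']
    constructor
    · intro hlt
      by_contra! hall
      have hs : Function.Surjective (slot t) := hall
      exact absurd (Fintype.card_le_of_surjective _ hs) (by omega)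
    · rintro ⟨s, hs⟩
      exact Fintype.card_lt_of_injective_of_notMem _ (slot_inj t) hs
  let T' := {t // Act t}
  let Ed' : T' → Type := fun t => {e : D.Ed t // Act (D.tgt t e)}
  let tgt' : ∀ t, Ed' t → T' := fun t e => ⟨D.tgt t e, e.2⟩
  let G : GDL X T' Ed' tgt' (ρ:ℝ) :=
    { E := fun t => K t
      L := fun t => ⋃ e : {e : D.Ed t // ¬ Act (D.tgt t e)}, D.S t e '' K (D.tgt t e)
      S := fun t e => D.S t e
      union := by
        intro t
        show K t = _
        rw [D.union t]
        ext x
        simp only [Set.mem_union, Set.mem_iUnion]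
        constructor
        · rintro ⟨e, h⟩
          by_cases he : Act (D.tgt t e)
          · exact Or.inr ⟨⟨e, he⟩, h⟩
          · exact Or.inl ⟨⟨e, he⟩, h⟩
        · rintro (⟨e, h⟩ | ⟨e, h⟩)
          · exact ⟨e, h⟩
          · exact ⟨e.1, h⟩
      compE := fun t => cK t
      compL := fun t => isCompact_iUnion fun e => by
        apply (cK _).image
        have : LipschitzWith ⟨ρ, hρ.le⟩ (D.S t e) :=
          LipschitzWith.of_dist_le_mul fun x y => (D.sim _ _ x y).le
        exact this.continuous
      nonE := fun t => nK t
      sim := fun t e x _ y _ => D.sim _ _ x y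
      disjL := by
        intro t e
        simp only [Set.disjoint_iUnion_left]
        intro e'
        apply D.disj
        intro h
        exact e'.2 (h ▸ e.2)
      disj := by
        intro t e e' h
        exact D.disj t e e' (fun h' => h (Subtype.ext h')) }
  let S' : ∀ t, Ed' t → Seq ρ → Seq ρ := fun t e x =>
    cons (b t e) (cons (if h : x 0 < w (D.tgt t e) then (d t e ⟨x 0, h⟩ : ℕ) else 0) (tl x))
  have memS' : ∀ t e y, y ∈ S' t e '' FF ρ M (w (D.tgt t e)) ↔
      (∃ i, y 0 = (slot t ⟨e, i⟩).1 ∧ y 1 = (slot t ⟨e, i⟩).2) ∧ ∀ n, y (n+2) < M := by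
    intro t e y
    constructor
    · rintro ⟨x, ⟨hx0, hx⟩, rfl⟩
      refine ⟨⟨⟨x 0, hx0⟩, rfl, ?_⟩, fun n => hx n⟩
      show (if h : x 0 < w (D.tgt t e) then (d t e ⟨x 0, h⟩ : ℕ) else 0) = _
      rw [dif_pos hx0]
    · rintro ⟨⟨i, h0, h1⟩, h2⟩
      refine ⟨cons i (tl (tl y)), ⟨i.2, fun n => h2 n⟩, ?_⟩
      show cons _ (cons (if h : (i:ℕ) < w (D.tgt t e) then (d t e ⟨i, h⟩ : ℕ) else 0) (tl (tl y))) = y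
      rw [dif_pos i.2]
      funext n
      rcases n with _ | _ | n
      · exact h0.symm
      · exact h1.symm
      · rfl
  let L' : T' → Set (Seq ρ) := fun t => ⋃ s : {s // s ∉ Set.range (slot t)},
    cons (s.1.1 : ℕ) '' (cons (s.1.2 : ℕ) '' Sig ρ M)
  have memL1 : ∀ (c c' : ℕ) (y : Seq ρ), y ∈ cons c '' (cons c' '' Sig ρ M) ↔
      y 0 = c ∧ y 1 = c' ∧ ∀ n, y (n+2) < M := by
    intro c c' y
    constructor
    · rintro ⟨z, ⟨x, hx, rfl⟩, rfl⟩
      exact ⟨rfl, rfl, hx⟩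
    · rintro ⟨h0, h1, h2⟩
      exact ⟨tl y, ⟨tl (tl y), h2, cons_tl' (tl y) h1⟩, cons_tl' y h0⟩
  have memL : ∀ t y, y ∈ L' t ↔
      (∃ s, s ∉ Set.range (slot t) ∧ y 0 = s.1 ∧ y 1 = s.2) ∧ ∀ n, y (n+2) < M := by
    intro t y
    simp only [L', Set.mem_iUnion, memL1]
    constructor
    · rintro ⟨s, h0, h1, h2⟩
      exact ⟨⟨s.1, s.2, h0, h1⟩, h2⟩
    · rintro ⟨⟨s, hs, h0, h1⟩, h2⟩
      exact ⟨⟨s, hs⟩, h0, h1, h2⟩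
  have L'comp1 : ∀ c c' : ℕ, IsCompact (cons c '' (cons c' '' Sig ρ M)) := fun c c' =>
    cons_image_compact _ (cons_image_compact _ (sig_compact M))
  let G' : GDL (Seq ρ) T' Ed' tgt' (ρ:ℝ) :=
    { E := fun t => FF ρ M (w t)
      L := L'
      S := S'
      union := by
        intro t
        ext y
        simp only [Set.mem_union, Set.mem_iUnion, memL, tgt', memS']
        constructor
        · rintro ⟨h0, h⟩
          by_cases hs : ((⟨y 0, h0⟩, ⟨y 1, h 0⟩) : Fin (w t) × Fin M) ∈ Set.range (slot t)
          · obtain ⟨⟨e, i⟩, hi⟩ := hs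
            refine Or.inr ⟨e, ⟨i, ?_, ?_⟩, fun n => h (n+1)⟩
            · rw [hi]
            · rw [hi]
          · exact Or.inl ⟨⟨_, hs, rfl, rfl⟩, fun n => h (n+1)⟩
        · rintro (⟨⟨s, -, h0, h1⟩, h2⟩ | ⟨e, ⟨i, h0, h1⟩, h2⟩)
          · refine ⟨h0 ▸ s.1.2, fun n => ?_⟩
            cases n with
            | zero => exact h1 ▸ s.2.2
            | succ n => exact h2 n
          · refine ⟨h0 ▸ (slot t ⟨e, i⟩).1.2, fun n => ?_⟩
            cases n with
            | zero => exact h1 ▸ (slot t ⟨e, i⟩).2.2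
            | succ n => exact h2 n
      compE := fun t => ff_compact _ _
      compL := fun t => isCompact_iUnion fun s => L'comp1 _ _
      nonE := fun t => ⟨_, zero_mem_ff (by omega) (hw t)⟩
      sim := by
        rintro t e x ⟨hx0, hx⟩ y ⟨hy0, hy⟩
        have hx0 : x 0 < w (D.tgt t e) := hx0
        have hy0 : y 0 < w (D.tgt t e) := hy0
        simp only [S', dif_pos hx0, dif_pos hy0]
        rw [dist_cons]
        congr 1
        by_cases hxy : x 0 = y 0
        · rw [dist_of_eq x y hxy]
          simp only [hxy]
          rw [dist_cons]
        · rw [dist_of_ne x y hxy, dist_of_ne]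
          intro hc
          have := hd t e e ⟨x 0, hx0⟩ ⟨y 0, hy0⟩ rfl (Fin.ext hc)
          simp at this
          exact hxy this
      disjL := by
        intro t e
        rw [Set.disjoint_left]
        intro y hy hy'
        rw [memL] at hy
        rw [memS'] at hy'
        obtain ⟨⟨s, hs, h0, h1⟩, -⟩ := hy
        obtain ⟨⟨i, h0', h1'⟩, -⟩ := hy'
        apply hs
        refine ⟨⟨e, i⟩, ?_⟩
        apply Prod.ext
        · exact Fin.ext (h0'.symm.trans h0)
        · exact Fin.ext (h1'.symm.trans h1)
      disj := by
        intro t e e' hne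
        rw [Set.disjoint_left]
        intro y hy hy'
        rw [memS'] at hy hy'
        obtain ⟨⟨i, h0, h1⟩, -⟩ := hy
        obtain ⟨⟨i', h0', h1'⟩, -⟩ := hy'
        apply hne
        have := slot_inj t (Prod.ext (Fin.ext (h0.symm.trans h0')) (Fin.ext (h1.symm.trans h1')))
        exact congrArg Sigma.fst this }
  have hL : ∀ t, BE (G.L t) (G'.L t) := by
    intro t
    by_cases hlf : ∃ e, ¬ Act (D.tgt t e)
    · obtain ⟨s0, hs0⟩ := (slot_free t).1 hlf
      obtain ⟨e0, he0⟩ := hlf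
      have : Nonempty {e : D.Ed t // ¬ Act (D.tgt t e)} := ⟨⟨e0, he0⟩⟩
      have : Nonempty {s // s ∉ Set.range (slot t)} := ⟨⟨s0, hs0⟩⟩
      have g1 : BE (G.L t) (Sig ρ M) := by
        apply good_iUnion hM
        · intro e
          exact (BE.image hρ (D.S t e) (fun x _ y _ => D.sim _ _ x y)).symm.trans
            (hgood t t.2 e e.2)
        · intro e
          apply (cK _).image
          have : LipschitzWith ⟨ρ, hρ.le⟩ (D.S t e) :=
            LipschitzWith.of_dist_le_mul fun x y => (D.sim _ _ x y).le
          exact this.continuous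
        · intro e e' h
          exact D.disj _ _ _ (fun h' => h (Subtype.ext h'))
      have g2 : BE (G'.L t) (Sig ρ M) := by
        apply good_iUnion hM
        · intro s
          exact ((BE.image hρ (cons _) (fun x _ y _ => dist_cons _ x y)).trans
            (BE.image hρ (cons _) (fun x _ y _ => dist_cons _ x y))).symm
        · intro s
          exact L'comp1 _ _
        · intro s s' h
          rw [Set.disjoint_left]
          intro y hy hy'
          rw [memL1] at hy hy'
          exact h (Subtype.ext (Prod.ext (Fin.ext (hy.1.symm.trans hy'.1))
            (Fin.ext (hy.2.1.symm.trans hy'.2.1))))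
      exact g1.trans g2.symm
    · have hns : ¬ ∃ s, s ∉ Set.range (slot t) := fun h => hlf ((slot_free t).2 h)
      have e1 : G.L t = ∅ := by
        apply Set.eq_empty_of_forall_notMem
        intro x hx
        obtain ⟨e, -⟩ := Set.mem_iUnion.1 hx
        exact hlf ⟨e.1, e.2⟩
      have e2 : G'.L t = ∅ := by
        apply Set.eq_empty_of_forall_notMem
        intro x hx
        obtain ⟨s, -⟩ := Set.mem_iUnion.1 hx
        exact hns ⟨s.1, s.2⟩
      rw [e1, e2]
      exact BE.empty
  have : ∀ t, Finite (Ed' t) := fun t => inferInstanceAs (Finite {e : D.Ed t // Act (D.tgt t e)})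
  have : Finite T' := inferInstanceAs (Finite {t // Act t})
  exact (lemmaA hρ hρ1 G G' hL ⟨t, ht⟩).trans (good_ff hM (hw t))
end gds
end GDP



namespace GDP

theorem int_eigen {p : ℕ} (a : Fin p → Fin p → ℕ) (m : ℕ) (v : Fin p → ℝ) (hv : ∀ i, 0 < v i)
    (h : ∀ i, ∑ j, (a i j : ℝ) * v j = (m : ℝ) * v i) :
    ∃ u : Fin p → ℕ, (∀ i, 0 < u i) ∧ ∀ i, ∑ j, a i j * u j = m * u i := by
  let W := Submodule.span ℚ (Set.range v)
  have : FiniteDimensional ℚ W := FiniteDimensional.span_of_finite ℚ (Set.finite_range v)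
  let β := Module.finBasis ℚ W
  let v' : Fin p → W := fun i => ⟨v i, Submodule.subset_span ⟨i, rfl⟩⟩
  have hv' : ∀ i, ∑ j, a i j • v' j = m • v' i := by
    intro i
    apply Subtype.ext
    simpa [v'] using h i
  let F : (Fin (Module.finrank ℚ W) → ℝ) → Fin p → ℝ := fun y i => ∑ s, (β.repr (v' i) s : ℝ) * y s
  have hF : Continuous F := by
    fun_prop
  have hFβ : ∀ i, F (fun s => (β s : ℝ)) i = v i := by
    intro i
    have := congrArg (fun x : W => (x : ℝ)) (β.sum_repr (v' i))
    simp only [Submodule.coe_sum, Submodule.coe_smul, Rat.smul_def] at this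
    exact this
  have hopen : IsOpen {y | ∀ i, 0 < F y i} := by
    have : {y | ∀ i, 0 < F y i} = ⋂ i, {y | 0 < F y i} := by
      ext y
      simp
    rw [this]
    apply isOpen_iInter_of_finite
    intro i
    exact isOpen_lt continuous_const ((continuous_apply i).comp hF)
  have hdense : DenseRange (fun (q : Fin (Module.finrank ℚ W) → ℚ) s => (q s : ℝ)) :=
    DenseRange.piMap (fun _ => Rat.denseRange_cast)
  obtain ⟨q, hq⟩ := hdense.exists_mem_open hopen ⟨fun s => (β s : ℝ), fun i => by
    rw [hFβ]
    exact hv i⟩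
  let φ : W →ₗ[ℚ] ℚ := β.constr ℚ q
  have hφ : ∀ i, 0 < φ (v' i) := by
    intro i
    have h1 := hq i
    have h2 : ((φ (v' i) : ℚ) : ℝ) = F (fun s => (q s : ℝ)) i := by
      simp only [φ, Module.Basis.constr_apply_fintype, F]
      push_cast
      simp [Module.Basis.equivFun_apply]
    rw [← h2] at h1
    exact_mod_cast h1
  have hφe : ∀ i, ∑ j, (a i j : ℚ) * φ (v' j) = m * φ (v' i) := by
    intro i
    have := congrArg φ (hv' i)
    simpa using this
  let N : ℕ := ∏ i, (φ (v' i)).den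
  have hN : 0 < N := Finset.prod_pos fun i _ => Rat.den_pos _
  have hz : ∀ i, ∃ z : ℕ, (z : ℚ) = N * φ (v' i) := by
    intro i
    obtain ⟨c, hc⟩ : (φ (v' i)).den ∣ N := Finset.dvd_prod_of_mem _ (Finset.mem_univ i)
    refine ⟨c * (φ (v' i)).num.toNat, ?_⟩
    have hnum : 0 < (φ (v' i)).num := Rat.num_pos.2 (hφ i)
    have h1 : (((φ (v' i)).num.toNat : ℕ) : ℚ) = (φ (v' i)).num := by
      exact_mod_cast Int.toNat_of_nonneg hnum.le
    push_cast
    rw [h1, hc]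
    have := Rat.den_mul_eq_num (φ (v' i))
    push_cast
    rw [← this]
    ring
  choose u hu using hz
  refine ⟨u, ?_, ?_⟩
  · intro i
    have : (0:ℚ) < u i := by
      rw [hu]
      have := hφ i
      positivity
    exact_mod_cast this
  · intro i
    have : (∑ j, (a i j : ℚ) * u j) = m * u i := by
      simp only [hu]
      have := hφe i
      calc _ = N * ∑ j, (a i j : ℚ) * φ (v' j) := by
            rw [Finset.mul_sum]
            exact Finset.sum_congr rfl fun j _ => by ring
        _ = _ := by
            rw [this]
            ring
    exact_mod_cast this

theorem distrib {α : Type*} [Fintype α] {n : ℕ} (x : Fin n → ℕ) (h : ∑ β, x β = Fintype.card α) :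
    ∃ b : α → Fin n, ∀ β, Fintype.card {a // b a = β} = x β := by
  have hc : Fintype.card α = Fintype.card (Σ β, Fin (x β)) := by
    rw [← h]
    simp
  let e := Fintype.equivOfCardEq hc
  refine ⟨fun a => (e a).1, fun β => ?_⟩
  have e1 : {a // (e a).1 = β} ≃ {s : Σ β, Fin (x β) // s.1 = β} :=
    e.subtypeEquiv (fun a => Iff.rfl)
  have e2 : {s : Σ β, Fin (x β) // s.1 = β} ≃ Fin (x β) := Equiv.sigmaSubtype β
  rw [Fintype.card_congr (e1.trans e2), Fintype.card_fin]

theorem num2 {T : Type*} (s : Finset T) (w c : T → ℕ) {n M σ : ℕ} (hn : 0 < n)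
    (h : ∑ t ∈ s, c t * w t + σ = n * M) (hσ : n * (n * ∑ t ∈ s, w t) ≤ σ) :
    ∃ x : T → Fin n → ℕ, (∀ t, ∑ β, x t β = c t) ∧ ∀ β, ∑ t ∈ s, x t β * w t ≤ M := by
  refine ⟨fun t β => c t / n + if β = ⟨0, hn⟩ then c t % n else 0, ?_, ?_⟩
  · intro t
    rw [Finset.sum_add_distrib]
    simp only [Finset.sum_const, Finset.card_univ, Fintype.card_fin, Finset.sum_ite_eq',
      Finset.mem_univ, if_true, smul_eq_mul]
    exact Nat.div_add_mod _ _
  · intro β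
    apply Nat.le_of_mul_le_mul_left _ hn
    rw [← h]
    refine le_trans ?_ (Nat.add_le_add_left hσ _)
    rw [Finset.mul_sum, Finset.mul_sum, Finset.mul_sum, ← Finset.sum_add_distrib]
    apply Finset.sum_le_sum
    intro t _
    have h1 : (if β = ⟨0, hn⟩ then c t % n else 0) ≤ n := by
      split_ifs
      · exact (Nat.mod_lt _ hn).le
      · omega
    have h2 : n * (c t / n) ≤ c t := Nat.mul_div_le _ _
    calc n * ((c t / n + if β = ⟨0, hn⟩ then c t % n else 0) * w t)
        ≤ n * ((c t / n + n) * w t) := by gcongr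
      _ = (n * (c t / n)) * w t + n * (n * w t) := by ring
      _ ≤ _ := by gcongr

theorem num1 {T : Type*} (s : Finset T) (w : T → ℕ) (ζ : T → ℤ) (hζ : ∑ t ∈ s, ζ t * w t = 1)
    (c : T → ℕ) {n M : ℕ} (hn : 0 < n)
    (h : ∑ t ∈ s, c t * w t = n * M)
    (hc : ∀ t ∈ s, n * (n * ((∑ u ∈ s, w u) * (ζ t).natAbs)) ≤ c t) :
    ∃ x : T → Fin n → ℕ, (∀ t ∈ s, ∑ β, x t β = c t) ∧ ∀ β, ∑ t ∈ s, x t β * w t ≤ M := by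
  have hsplit : n * M = n * ∑ t ∈ s, (c t / n) * w t + ∑ t ∈ s, (c t % n) * w t := by
    rw [← h, Finset.mul_sum, ← Finset.sum_add_distrib]
    apply Finset.sum_congr rfl
    intro t _
    conv_lhs => rw [← Nat.div_add_mod (c t) n]
    ring
  have hdvd : n ∣ ∑ t ∈ s, (c t % n) * w t :=
    (Nat.dvd_add_right (Dvd.intro _ rfl)).1 (hsplit ▸ Dvd.intro _ rfl)
  obtain ⟨δ, hδ⟩ := hdvd
  have hM : M = ∑ t ∈ s, (c t / n) * w t + δ := by
    rw [hδ, ← mul_add] at hsplit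
    exact Nat.eq_of_mul_eq_mul_left hn hsplit
  have hδW : δ ≤ ∑ u ∈ s, w u := by
    apply Nat.le_of_mul_le_mul_left _ hn
    rw [← hδ, Finset.mul_sum]
    apply Finset.sum_le_sum
    intro t _
    gcongr
    exact (Nat.mod_lt _ hn).le
  let q : T → ℤ := fun t => (c t / n : ℕ) + δ * ζ t
  have hbd : ∀ t ∈ s, (n : ℤ) * |δ * ζ t| ≤ (c t / n : ℕ) := by
    intro t ht
    have h1 : n * (δ * (ζ t).natAbs) ≤ c t / n := by
      rw [Nat.le_div_iff_mul_le hn]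
      refine le_trans ?_ (hc t ht)
      rw [mul_comm _ n]
      gcongr
    rw [abs_mul, Nat.abs_cast, Int.abs_eq_natAbs]
    exact_mod_cast h1
  have hn1 : (1:ℤ) ≤ n := by exact_mod_cast hn
  have hq0 : ∀ t ∈ s, 0 ≤ q t := by
    intro t ht
    have h1 := hbd t ht
    have h2 := neg_abs_le ((δ:ℤ) * ζ t)
    have h3 := abs_nonneg ((δ:ℤ) * ζ t)
    simp only [q]
    nlinarith
  have hl0 : ∀ t ∈ s, 0 ≤ (c t : ℤ) - (n - 1) * q t := by
    intro t ht
    have h1 := hbd t ht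
    have h2 := le_abs_self ((δ:ℤ) * ζ t)
    have h3 := abs_nonneg ((δ:ℤ) * ζ t)
    have h4 : (n : ℤ) * (c t / n : ℕ) ≤ c t := by exact_mod_cast Nat.mul_div_le (c t) n
    simp only [q]
    nlinarith
  have hqs : ∑ t ∈ s, q t * w t = M := by
    simp only [q, add_mul, Finset.sum_add_distrib]
    have : ∑ t ∈ s, (δ:ℤ) * ζ t * w t = δ := by
      simp only [mul_assoc]
      rw [← Finset.mul_sum, hζ, mul_one]
    rw [this, hM]
    push_cast
    rfl
  let x : T → Fin n → ℤ := fun t β => if β = ⟨0, hn⟩ then (c t : ℤ) - (n - 1) * q t else q t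
  have hx0 : ∀ t ∈ s, ∀ β, 0 ≤ x t β := by
    intro t ht β
    simp only [x]
    split_ifs
    · exact hl0 t ht
    · exact hq0 t ht
  refine ⟨fun t β => (x t β).toNat, ?_, ?_⟩
  · intro t ht
    have : ∑ β, x t β = c t := by
      have e : ∀ β, x t β = q t + if β = ⟨0, hn⟩ then (c t : ℤ) - n * q t else 0 := by
        intro β
        simp only [x]
        split_ifs <;> ring
      simp only [e, Finset.sum_add_distrib, Finset.sum_const, Finset.card_univ, Fintype.card_fin,
        Finset.sum_ite_eq', Finset.mem_univ, if_true, nsmul_eq_mul]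
      ring
    zify
    rw [← this]
    exact Finset.sum_congr rfl fun β _ => by rw [Int.toNat_of_nonneg (hx0 t ht β)]
  · intro β
    apply le_of_eq
    have : ∑ t ∈ s, x t β * w t = M := by
      simp only [x]
      split_ifs
      · have e : ∀ t, ((c t : ℤ) - (n - 1) * q t) * w t = (c t : ℤ) * w t - (n - 1) * (q t * w t) :=
          fun t => by ring
        simp only [e, Finset.sum_sub_distrib]
        rw [← Finset.mul_sum, hqs]
        have : ∑ t ∈ s, (c t : ℤ) * w t = n * M := by exact_mod_cast h
        rw [this]
        ring
      · exact hqs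
    zify
    rw [← this]
    exact Finset.sum_congr rfl fun t ht => by rw [Int.toNat_of_nonneg (hx0 t ht β)]

end GDP



namespace GDP
section gds2
variable {X : Type*} [MetricSpace X] {T : Type} {K : T → Set X} [Fintype T]

theorem GDS.Counts.card {ρ : ℝ} {D : GDS X T ρ K} {B : Matrix T T ℕ} (hB : D.Counts B) (t t' : T) :
    Fintype.card {e : D.Ed t // D.tgt t e = t'} = B t t' := by
  have := hB t (fun u => if u = t' then 1 else 0)
  simp only [mul_ite, mul_one, mul_zero, Finset.sum_ite_eq', Finset.mem_univ, if_true] at this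
  rw [← this, Fintype.card_subtype]
  simp

theorem lemmaM' {ρ : Set.Ioo (0:ℝ) 1} (D : GDS X T (ρ:ℝ) K) {B : Matrix T T ℕ} (hB : D.Counts B)
    (cK : ∀ t, IsCompact (K t)) (nK : ∀ t, (K t).Nonempty) (Act : T → Prop) (w : T → ℕ)
    (hw : ∀ t, 0 < w t) {M : ℕ} (hM : 2 ≤ M)
    (hx : ∀ t, Act t → ∃ x : T → Fin (w t) → ℕ, (∀ t', Act t' → ∑ β, x t' β = B t t') ∧
      ∀ β, ∑ t' with Act t', x t' β * w t' ≤ M)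
    (hgood : ∀ t t', Act t → ¬ Act t' → B t t' ≠ 0 → BE (K t') (Sig ρ M))
    (hleaf : ∀ t, Act t → ((∃ t', ¬ Act t' ∧ B t t' ≠ 0) ↔
      ∑ t' with Act t', B t t' * w t' < w t * M)) (t : T) (ht : Act t) :
    BE (K t) (Sig ρ M) := by
  have hedge : ∀ t (e : D.Ed t), B t (D.tgt t e) ≠ 0 := by
    intro t e
    rw [← hB.card]
    have : Nonempty {e' : D.Ed t // D.tgt t e' = D.tgt t e} := ⟨⟨e, rfl⟩⟩
    exact Fintype.card_ne_zero
  choose x hx1 hx2 using fun t : {t // Act t} => hx t t.2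
  have hbb : ∀ (t : {t // Act t}), ∀ t', ∃ b : {e : D.Ed t // D.tgt t e = t'} → Fin (w t),
      Act t' → ∀ β, Fintype.card {a // b a = β} = x t t' β := by
    intro t t'
    by_cases h : Act t'
    · obtain ⟨b, hb⟩ := distrib (α := {e : D.Ed t // D.tgt t e = t'}) (x t t')
        (by rw [hx1 t t' h, hB.card])
      exact ⟨b, fun _ => hb⟩
    · exact ⟨fun _ => ⟨0, hw t⟩, fun h' => (h h').elim⟩
  choose bb hbb using hbb
  refine lemmaM D cK nK Act w hw hM (fun t e => bb t (D.tgt t e) ⟨e, rfl⟩) ?_ ?_ ?_ t ht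
  · intro t β
    refine le_trans ?_ (hx2 t β)
    rw [← Finset.sum_fiberwise_of_maps_to (g := fun e : {e : D.Ed t // Act (D.tgt t e)} => D.tgt t e)
      (t := Finset.univ.filter Act) (by
        intro e _
        simpa using e.2)]
    apply Finset.sum_le_sum
    intro t' ht'
    have hA : Act t' := by simpa using ht'
    rw [← hbb t t' hA β]
    have h1 : ∀ e ∈ (Finset.univ.filter fun e : {e : D.Ed t // Act (D.tgt t e)} =>
        bb t (D.tgt t e) ⟨e, rfl⟩ = β).filter (fun e : {e : D.Ed t // Act (D.tgt t e)} => D.tgt t e = t'), w (D.tgt t e) = w t' := by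
      intro e he
      rw [(Finset.mem_filter.1 he).2]
    rw [Finset.sum_congr rfl h1, Finset.sum_const, smul_eq_mul]
    apply Nat.mul_le_mul_right
    let F : {a : {e : D.Ed t // D.tgt t e = t'} // bb t t' a = β} →
        {e : D.Ed t // Act (D.tgt t e)} := fun s => ⟨s.1.1, by rw [s.1.2]; exact hA⟩
    have hsub : (Finset.univ.filter fun e : {e : D.Ed t // Act (D.tgt t e)} =>
        bb t (D.tgt t e) ⟨e, rfl⟩ = β).filter (fun e : {e : D.Ed t // Act (D.tgt t e)} => D.tgt t e = t') ⊆
        Finset.univ.image F := by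
      rintro ⟨e, he⟩ h
      simp only [Finset.mem_filter, Finset.mem_univ, true_and] at h
      obtain ⟨h2, rfl⟩ := h
      exact Finset.mem_image.2 ⟨⟨⟨e, rfl⟩, h2⟩, Finset.mem_univ _, rfl⟩
    refine (Finset.card_le_card hsub).trans (Finset.card_image_le.trans ?_)
    rw [Finset.card_univ]
  · intro t hA e he
    exact hgood t _ hA he (hedge t e)
  · intro t
    have e1 : (∃ e, ¬ Act (D.tgt t e)) ↔ ∃ t', ¬ Act t' ∧ B t t' ≠ 0 := by
      constructor
      · rintro ⟨e, he⟩
        exact ⟨_, he, hedge _ e⟩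
      · rintro ⟨t', h1, h2⟩
        rw [← hB.card] at h2
        obtain ⟨e⟩ := Fintype.card_pos_iff.1 (Nat.pos_of_ne_zero h2)
        exact ⟨e.1, by rw [e.2]; exact h1⟩
    rw [e1, hleaf t t.2]
    have e2 : ∑ e : {e : D.Ed t // Act (D.tgt t e)}, w (D.tgt t e) =
        ∑ t' with Act t', B t t' * w t' := by
      rw [Finset.sum_filter]
      have := hB t (fun u => if Act u then w u else 0)
      simp only [mul_ite, mul_zero] at this
      rw [← this, ← Finset.sum_filter]
      exact (Finset.sum_subtype (p := fun e => Act (D.tgt t e)) _ (by simp)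
        (fun e => w (D.tgt t e))).symm
    rw [e2]
end gds2

section mat
variable {T : Type} [Fintype T]

theorem mul_pos_iff' (A B : Matrix T T ℕ) (i j : T) :
    0 < (A * B) i j ↔ ∃ l, 0 < A i l ∧ 0 < B l j := by
  rw [Matrix.mul_apply, Finset.sum_pos_iff]
  simp

theorem exists_idem (A : Matrix T T ℕ) : ∃ k, 0 < k ∧ ∀ i j, 0 < (A ^ k * A ^ k) i j →
    0 < (A ^ k) i j := by
  let f : ℕ → Set (T × T) := fun n => {x | 0 < (A ^ (n+1)) x.1 x.2}
  have hf : ¬ Function.Injective f := not_injective_infinite_finite f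
  have h1 : ∃ a b, a < b ∧ f a = f b := by
    simp only [Function.Injective, not_forall] at hf
    obtain ⟨a, b, h, hne⟩ := hf
    rcases lt_or_gt_of_ne hne with h' | h'
    · exact ⟨a, b, h', h⟩
    · exact ⟨b, a, h', h.symm⟩
  obtain ⟨a, b, hab, h⟩ := h1
  have hs : ∀ q i j, 0 < (A ^ (a + 1 + q)) i j ↔ 0 < (A ^ (b + 1 + q)) i j := by
    intro q i j
    rw [pow_add, pow_add A (b+1), mul_pos_iff', mul_pos_iff']
    have : ∀ l, 0 < (A ^ (a+1)) i l ↔ 0 < (A ^ (b+1)) i l := fun l =>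
      Set.ext_iff.1 h (i, l)
    simp only [this]
  obtain ⟨d, rfl⟩ : ∃ d, b = a + d := ⟨b - a, by omega⟩
  have hj : ∀ c n, a + 1 ≤ n → ∀ i j, 0 < (A ^ (n + c * d)) i j ↔ 0 < (A ^ n) i j := by
    intro c
    induction c with
    | zero => intro n _ i j; simp
    | succ c ih =>
      intro n hn i j
      rw [← ih n hn i j]
      obtain ⟨q, hq⟩ : ∃ q, n + c * d = a + 1 + q := ⟨n + c * d - (a+1), by omega⟩
      rw [hq, hs]
      have : n + (c + 1) * d = a + d + 1 + q := by
        rw [add_mul]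
        omega
      rw [this]
  have hd : 0 < d := by omega
  refine ⟨(a+1) * d, by positivity, fun i j => ?_⟩
  rw [← pow_add]
  exact (hj (a+1) _ (Nat.le_mul_of_pos_right _ hd) i j).1

theorem pow_eigen (A : Matrix T T ℕ) (v : T → ℕ) (m : ℕ) (h : ∀ i, ∑ j, A i j * v j = m * v i)
    (k : ℕ) (i : T) : ∑ j, (A ^ k) i j * v j = m ^ k * v i := by
  have h0 : A.mulVec v = m • v := by
    funext i
    exact h i
  have : (A ^ k).mulVec v = m ^ k • v := by
    induction k with
    | zero => simp
    | succ k ih =>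
      rw [pow_succ, ← Matrix.mulVec_mulVec, h0, Matrix.mulVec_smul, ih, smul_smul, pow_succ']
  exact congrFun this i

end mat
end GDP



namespace GDP

theorem bezout {T : Type*} (s : Finset T) (v : T → ℕ) (hs : s.Nonempty) (hv : ∀ t, 0 < v t) :
    ∃ (g : ℕ) (w : T → ℕ) (ζ : T → ℤ), 0 < g ∧ (∀ t, 0 < w t) ∧ (∀ t ∈ s, v t = g * w t) ∧
      ∑ t ∈ s, ζ t * w t = 1 := by
  have key : ∀ s : Finset T, ∃ (g : ℕ) (ζ : T → ℤ), (∀ t ∈ s, g ∣ v t) ∧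
      ∑ t ∈ s, ζ t * v t = g := by
    intro s
    induction s using Finset.induction_on with
    | empty => exact ⟨0, 0, by simp, by simp⟩
    | insert a s ha ih =>
      obtain ⟨g, ζ, h1, h2⟩ := ih
      refine ⟨Nat.gcd (v a) g, fun t => if t = a then Nat.gcdA (v a) g else
        Nat.gcdB (v a) g * ζ t, ?_, ?_⟩
      · intro t ht
        rcases Finset.mem_insert.1 ht with rfl | ht
        · exact Nat.gcd_dvd_left _ _
        · exact (Nat.gcd_dvd_right _ _).trans (h1 t ht)
      · rw [Finset.sum_insert ha, Nat.gcd_eq_gcd_ab]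
        beta_reduce
        rw [if_pos rfl]
        have : ∀ t ∈ s, (if t = a then Nat.gcdA (v a) g else Nat.gcdB (v a) g * ζ t) * (v t : ℤ) =
            Nat.gcdB (v a) g * (ζ t * v t) := by
          intro t ht
          rw [if_neg (fun h : t = a => ha (h ▸ ht))]
          ring
        rw [Finset.sum_congr rfl this, ← Finset.mul_sum, h2]
        ring
  obtain ⟨g, ζ, h1, h2⟩ := key s
  obtain ⟨a, ha⟩ := hs
  have hg : 0 < g := Nat.pos_of_dvd_of_pos (h1 a ha) (hv a)
  have hw : ∀ t ∈ s, v t = g * (v t / g) := fun t ht => (Nat.mul_div_cancel' (h1 t ht)).symm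
  refine ⟨g, fun t => if t ∈ s then v t / g else 1, ζ, hg, ?_, ?_, ?_⟩
  · intro t
    show 0 < if t ∈ s then v t / g else 1
    split_ifs with h
    · exact Nat.div_pos (Nat.le_of_dvd (hv t) (h1 t h)) hg
    · exact one_pos
  · intro t ht
    simp only [if_pos ht]
    exact hw t ht
  · have hg' : (g : ℤ) ≠ 0 := by exact_mod_cast hg.ne'
    apply mul_left_cancel₀ hg'
    rw [mul_one, Finset.mul_sum]
    refine Eq.trans ?_ h2
    apply Finset.sum_congr rfl
    intro t ht
    simp only [if_pos ht]
    have := hw t ht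
    have h3 : (v t : ℤ) = g * ((v t / g : ℕ) : ℤ) := by exact_mod_cast this
    rw [h3]
    push_cast
    ring

theorem good_all {X : Type*} [MetricSpace X] {T : Type} [Fintype T] {K : T → Set X} {r : ℝ}
    (hr : 0 < r) (D : GDS X T r K) (A : Matrix T T ℕ) (hA : D.Counts A)
    (cK : ∀ t, IsCompact (K t)) (nK : ∀ t, (K t).Nonempty) (v : T → ℕ) (hv : ∀ t, 0 < v t)
    (m : ℕ) (hm : 2 ≤ m) (heig : ∀ i, ∑ j, A i j * v j = m * v i) :
    ∃ k n₁ : ℕ, 0 < k ∧ ∀ n, n₁ ≤ n → 0 < n → ∀ ρ : Set.Ioo (0:ℝ) 1, (ρ:ℝ) = r ^ (k * n) →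
      ∀ i, BE (K i) (Sig ρ (m ^ (k * n))) := by
  obtain ⟨k, hk, hidem⟩ := exists_idem A
  set P := A ^ k with hP
  let R : T → T → Prop := fun i j => 0 < P i j
  have Rtrans : ∀ i j l, R i j → R j l → R i l := fun i j l h1 h2 =>
    hidem i l ((mul_pos_iff' _ _ _ _).2 ⟨j, h1, h2⟩)
  have hPe : ∀ n i, ∑ j, (P ^ n) i j * v j = m ^ (k * n) * v i := by
    intro n i
    rw [hP, ← pow_mul]
    exact pow_eigen A v m heig (k * n) i
  have Rser : ∀ i, ∃ j, R i j := by
    intro i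
    have h1 := hPe 1 i
    have h2 : 0 < ∑ j, (P ^ 1) i j * v j := by
      rw [h1]
      have := hv i
      positivity
    rw [Finset.sum_pos_iff] at h2
    obtain ⟨j, -, hj⟩ := h2
    rw [pow_one] at hj
    exact ⟨j, Nat.pos_of_mul_pos_right hj⟩
  have Rpow : ∀ n i j, 0 < (P ^ (n+1)) i j → R i j := by
    intro n
    induction n with
    | zero => intro i j h; simpa using h
    | succ n ih =>
      intro i j h
      rw [pow_succ, mul_pos_iff'] at h
      obtain ⟨l, h1, h2⟩ := h
      exact Rtrans _ _ _ (ih _ _ h1) h2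
  let Term : T → Prop := fun t => ∀ l, R t l → R l t
  have exTerm : ∀ i, ∃ t, R i t ∧ Term t := by
    intro i
    let suc : T → Finset T := fun l => Finset.univ.filter (R l)
    have hsuc : ∀ l j, R l j → suc j ⊆ suc l := by
      intro l j h q hq
      simp only [suc, Finset.mem_filter, Finset.mem_univ, true_and] at hq ⊢
      exact Rtrans _ _ _ h hq
    obtain ⟨l, hl, hmin⟩ := Finset.exists_min_image (suc i) (fun l => (suc l).card) (by
      obtain ⟨j, hj⟩ := Rser i
      exact ⟨j, by simpa [suc] using hj⟩)
    have hil : R i l := by simpa [suc] using hl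
    have heq : ∀ q, R l q → suc q = suc l := by
      intro q hq
      apply Finset.eq_of_subset_of_card_le (hsuc _ _ hq)
      apply hmin
      simpa [suc] using Rtrans _ _ _ hil hq
    obtain ⟨j, hj⟩ := Rser l
    refine ⟨j, Rtrans _ _ _ hil hj, ?_⟩
    intro q hq
    have : j ∈ suc q := by
      rw [heq q (Rtrans _ _ _ hj hq)]
      simpa [suc] using hj
    simpa [suc] using this
  have Trefl : ∀ t, Term t → R t t := by
    intro t ht
    obtain ⟨l, hl⟩ := Rser t
    exact Rtrans _ _ _ hl (ht l hl)
  let V := ∑ t, v t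
  have hvV : ∀ t, v t ≤ V := fun t => Finset.single_le_sum (fun _ _ => Nat.zero_le _) (Finset.mem_univ t)
  have abund : ∀ N t, Term t → ∀ n, N * V + 1 ≤ n → ∀ i j, R t i → R t j → N ≤ (P ^ n) i j := by
    intro N t ht n hn i j hi hj
    have hV : 0 < V := (hv t).trans_le (hvV t)
    obtain ⟨n, rfl⟩ : ∃ n', n = n' + 1 := ⟨n - 1, by omega⟩
    apply Nat.le_of_mul_le_mul_right _ hV
    have h1 : n ≤ m ^ (k * n) * v i := by
      have h2 : n < 2 ^ n := Nat.lt_two_pow_self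
      have h3 : 2 ^ n ≤ m ^ (k * n) :=
        (Nat.pow_le_pow_left hm n).trans (Nat.pow_le_pow_right (by omega)
          (Nat.le_mul_of_pos_left _ hk))
      have h4 : m ^ (k * n) ≤ m ^ (k * n) * v i := Nat.le_mul_of_pos_right _ (hv i)
      omega
    rw [← hPe] at h1
    refine le_trans (by omega : N * V ≤ n) (h1.trans ?_)
    rw [pow_succ, Matrix.mul_apply, Finset.sum_mul]
    apply Finset.sum_le_sum
    intro l _
    rcases Nat.eq_zero_or_pos ((P ^ n) i l) with h0 | h0
    · rw [h0]; simp
    · have hil : R t l := by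
        cases n with
        | zero =>
          rw [pow_zero, Matrix.one_apply] at h0
          split_ifs at h0 with h
          · exact h ▸ hi
          · omega
        | succ n => exact Rtrans _ _ _ hi (Rpow n _ _ h0)
      have hlj : R l j := Rtrans _ _ _ (ht l hil) hj
      have h5 : 1 ≤ P l j := hlj
      calc (P ^ n) i l * v l = (P ^ n) i l * 1 * v l := by ring
        _ ≤ (P ^ n) i l * P l j * V := by
          gcongr
          exact hvV l
  have hM2 : ∀ n, 0 < n → 2 ≤ m ^ (k * n) := fun n hn =>
    hm.trans (Nat.le_self_pow (by positivity) m)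
  have hD : ∀ n, ∀ ρ : Set.Ioo (0:ℝ) 1, (ρ:ℝ) = r ^ (k * n) →
      ∃ D' : GDS X T (ρ:ℝ) K, D'.Counts (P ^ n) := by
    intro n ρ hρ
    rw [hρ, hP, ← pow_mul]
    exact gds_pow hr D hA _
  have app1 : ∀ t, Term t → ∃ n₁, ∀ n, n₁ ≤ n → 0 < n → ∀ ρ : Set.Ioo (0:ℝ) 1,
      (ρ:ℝ) = r ^ (k * n) → BE (K t) (Sig ρ (m ^ (k * n))) := by
    intro t0 ht0
    obtain ⟨g, w, ζ, hg, hw, hvw, hζ⟩ := bezout (Finset.univ.filter (R t0)) v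
      ⟨t0, by simpa using Trefl t0 ht0⟩ hv
    let f : T → T → ℕ := fun t t' => w t * (w t * ((∑ u with R t0 u, w u) * (ζ t').natAbs))
    have hf : ∀ t t', f t t' ≤ ∑ t, ∑ t', f t t' := fun t t' =>
      (Finset.single_le_sum (f := fun t' => f t t') (fun _ _ => Nat.zero_le _)
        (Finset.mem_univ t')).trans
      (Finset.single_le_sum (f := fun t => ∑ t', f t t') (fun _ _ => Nat.zero_le _)
        (Finset.mem_univ t))
    refine ⟨(∑ t, ∑ t', f t t') * V + 1, fun n hn hn0 ρ hρ => ?_⟩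
    obtain ⟨D', hD'⟩ := hD n ρ hρ
    have hout : ∀ t t', R t0 t → ¬ R t0 t' → (P ^ n) t t' = 0 := by
      intro t t' h1 h2
      by_contra h3
      obtain ⟨n', rfl⟩ : ∃ n', n = n' + 1 := ⟨n - 1, by omega⟩
      exact h2 (Rtrans _ _ _ h1 (Rpow _ _ _ (Nat.pos_of_ne_zero h3)))
    have hsum : ∀ t, R t0 t → ∑ t' with R t0 t', (P ^ n) t t' * w t' = w t * m ^ (k * n) := by
      intro t ht
      have h1 := hPe n t
      rw [← Finset.sum_filter_add_sum_filter_not Finset.univ (R t0),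
        Finset.sum_eq_zero (s := Finset.univ.filter (fun x => ¬ R t0 x)), add_zero] at h1
      · apply Nat.eq_of_mul_eq_mul_left hg
        rw [Finset.mul_sum]
        rw [hvw t (by simpa using ht)] at h1
        rw [← mul_assoc, mul_comm, ← h1]
        apply Finset.sum_congr rfl
        intro t' ht'
        rw [hvw t' ht']
        ring
      · intro t' ht'
        rw [hout t t' ht (by simpa using ht'), zero_mul]
    refine lemmaM' D' hD' cK nK (R t0) w hw (hM2 n hn0) ?_ ?_ ?_ t0 (Trefl t0 ht0)
    · intro t ht
      obtain ⟨x, hx1, hx2⟩ := num1 (Finset.univ.filter (R t0)) w ζ hζ (fun t' => (P ^ n) t t')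
        (hw t) (hsum t ht) (by
          intro t' ht'
          exact (hf t t').trans (abund _ t0 ht0 n hn t t' ht (by simpa using ht')))
      exact ⟨x, fun t' ht' => hx1 t' (by simpa using ht'), by convert hx2⟩
    · intro t t' h1 h2 h3
      exact (h3 (hout t t' h1 h2)).elim
    · intro t ht
      constructor
      · rintro ⟨t', h1, h2⟩
        exact (h2 (hout t t' ht h1)).elim
      · intro h
        exact absurd h (not_lt.2 (le_of_eq (by convert (hsum t ht).symm)))
  have app1' : ∀ t, ∃ n₁, Term t → ∀ n, n₁ ≤ n → 0 < n → ∀ ρ : Set.Ioo (0:ℝ) 1,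
      (ρ:ℝ) = r ^ (k * n) → BE (K t) (Sig ρ (m ^ (k * n))) := by
    intro t
    by_cases ht : Term t
    · obtain ⟨n₁, h⟩ := app1 t ht
      exact ⟨n₁, fun _ => h⟩
    · exact ⟨0, fun h => (ht h).elim⟩
  choose n₁ hn₁ using app1'
  let N : ℕ := ∑ t, v t * (v t * V)
  have hN : ∀ t, v t * (v t * V) ≤ N := fun t =>
    Finset.single_le_sum (f := fun t => v t * (v t * V)) (fun _ _ => Nat.zero_le _) (Finset.mem_univ t)
  refine ⟨k, ∑ t, n₁ t + (N * V + 2), hk, fun n hn hn0 ρ hρ i => ?_⟩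
  have hTerm : ∀ t, Term t → BE (K t) (Sig ρ (m ^ (k * n))) := by
    intro t ht
    have : n₁ t ≤ ∑ t, n₁ t := Finset.single_le_sum (fun _ _ => Nat.zero_le _) (Finset.mem_univ t)
    exact hn₁ t ht n (by omega) hn0 ρ hρ
  by_cases hi : Term i
  · exact hTerm i hi
  obtain ⟨D', hD'⟩ := hD n ρ hρ
  have big : ∀ t, ∃ t', Term t' ∧ N ≤ (P ^ n) t t' := by
    intro t
    obtain ⟨t', h1, h2⟩ := exTerm t
    refine ⟨t', h2, ?_⟩
    obtain ⟨n', rfl⟩ : ∃ n', n = n' + 1 := ⟨n - 1, by omega⟩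
    have h3 := abund N t' h2 n' (by omega) t' t' (Trefl _ h2) (Trefl _ h2)
    rw [pow_succ', Matrix.mul_apply]
    refine h3.trans (le_trans ?_ (Finset.single_le_sum (f := fun l => P t l * (P ^ n') l t')
      (fun _ _ => Nat.zero_le _) (Finset.mem_univ t')))
    exact Nat.le_mul_of_pos_left _ h1
  have hNpos : ∀ t, 0 < v t * (v t * V) := by
    intro t
    have := hv t
    have := (hv t).trans_le (hvV t)
    positivity
  have hslack : ∀ t, v t * (v t * V) ≤ ∑ t' with ¬ ¬ Term t', (P ^ n) t t' * v t' := by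
    intro t
    obtain ⟨t', h1, h2⟩ := big t
    refine (hN t).trans (h2.trans ?_)
    refine le_trans (Nat.le_mul_of_pos_right _ (hv t')) ?_
    exact Finset.single_le_sum (f := fun t' => (P ^ n) t t' * v t') (fun _ _ => Nat.zero_le _)
      (by simpa using h1)
  have htot : ∀ t, ∑ t' with ¬ Term t', (P ^ n) t t' * v t' +
      ∑ t' with ¬ ¬ Term t', (P ^ n) t t' * v t' = v t * m ^ (k * n) := by
    intro t
    rw [Finset.sum_filter_add_sum_filter_not, hPe, mul_comm]
  refine lemmaM' D' hD' cK nK (fun t => ¬ Term t) v hv (hM2 n hn0) ?_ ?_ ?_ i hi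
  · intro t ht
    obtain ⟨x, hx1, hx2⟩ := num2 (Finset.univ.filter (fun t => ¬ Term t)) v (fun t' => (P ^ n) t t')
      (hv t) (htot t) (by
        refine le_trans ?_ (hslack t)
        gcongr
        exact Finset.sum_le_sum_of_subset (Finset.filter_subset _ _))
    exact ⟨x, fun t' _ => hx1 t', by convert hx2⟩
  · intro t t' _ h _
    exact hTerm t' (not_not.1 h)
  · intro t ht
    constructor
    · intro _
      have h1 := htot t
      have h2 := hslack t
      have h3 := hNpos t
      have h4 : ∑ t' with ¬ Term t', (P ^ n) t t' * v t' < v t * m ^ (k * n) := by omega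
      convert h4
    · intro _
      obtain ⟨t', h1, h2⟩ := big t
      have := hNpos t
      have := hN t
      exact ⟨t', not_not.2 h1, by omega⟩

end GDP



namespace GDP
open scoped NNReal ENNReal in
theorem sig_dim_le (ρ : Set.Ioo (0:ℝ) 1) (M : ℕ) (s : ℝ≥0)
    (h : (ρ:ℝ) ^ (s:ℝ) * M = 1) : dimH (Sig ρ M) ≤ s := by
  borelize (Seq ρ)
  have hρ := ρ.2.1
  have hρ1 := ρ.2.2
  apply dimH_le_of_hausdorffMeasure_ne_top
  have h1 := MeasureTheory.Measure.hausdorffMeasure_le_liminf_sum (X := Seq ρ) (β := ℕ)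
    (ι := fun n => Fin n → Fin M) (s:ℝ) (Sig ρ M) (l := Filter.atTop)
    (fun n => ENNReal.ofReal ((ρ:ℝ) ^ n)) (by
      have := ENNReal.tendsto_ofReal (tendsto_pow_atTop_nhds_zero_of_lt_one hρ.le hρ1)
      simpa using this)
    (fun n i => {x | ∀ j : Fin n, x j = i j}) (by
      refine Filter.Eventually.of_forall fun n i => ?_
      apply Metric.ediam_le
      intro x hx y hy
      rw [edist_dist]
      apply ENNReal.ofReal_le_ofReal
      apply seq_dist_le
      intro j hj
      exact (hx ⟨j, hj⟩).trans (hy ⟨j, hj⟩).symm) (by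
      refine Filter.Eventually.of_forall fun n x hx => ?_
      rw [Set.mem_iUnion]
      exact ⟨fun j => ⟨x j, hx j⟩, fun j => rfl⟩)
  have h2 : ∀ n, ∑ i : Fin n → Fin M, (Metric.ediam {x : Seq ρ | ∀ j : Fin n, x j = i j}) ^ (s:ℝ)
      ≤ 1 := by
    intro n
    calc _ ≤ ∑ i : Fin n → Fin M, ENNReal.ofReal (((ρ:ℝ) ^ n) ^ (s:ℝ)) := by
          apply Finset.sum_le_sum
          intro i _
          rw [← ENNReal.ofReal_rpow_of_nonneg (pow_nonneg hρ.le n) (NNReal.coe_nonneg s)]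
          apply ENNReal.rpow_le_rpow _ (NNReal.coe_nonneg s)
          apply Metric.ediam_le
          intro x hx y hy
          rw [edist_dist]
          apply ENNReal.ofReal_le_ofReal
          apply seq_dist_le
          intro j hj
          exact (hx ⟨j, hj⟩).trans (hy ⟨j, hj⟩).symm
      _ = ENNReal.ofReal ((M:ℝ) ^ n * ((ρ:ℝ) ^ n) ^ (s:ℝ)) := by
          rw [Finset.sum_const, Finset.card_univ, Fintype.card_fun, Fintype.card_fin,
            Fintype.card_fin, ← ENNReal.ofReal_nsmul, nsmul_eq_mul]
          push_cast
          rfl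
      _ ≤ 1 := by
          have : ((ρ:ℝ) ^ n) ^ (s:ℝ) = ((ρ:ℝ) ^ (s:ℝ)) ^ n := by
            rw [← Real.rpow_natCast, ← Real.rpow_natCast, ← Real.rpow_mul hρ.le,
              ← Real.rpow_mul hρ.le, mul_comm]
          rw [this, ← mul_pow, mul_comm, h]
          simp
  have h3 : MeasureTheory.Measure.hausdorffMeasure (s:ℝ) (Sig ρ M) ≤ 1 := by
    refine h1.trans ?_
    refine (Filter.liminf_le_liminf (Filter.Eventually.of_forall h2)).trans ?_
    simp
  exact (h3.trans_lt ENNReal.one_lt_top).ne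

open scoped NNReal ENNReal in
theorem sig_dim_ge (ρ : Set.Ioo (0:ℝ) 1) (M : ℕ) (hM : 2 ≤ M) (s : ℝ≥0) (hs : 0 < s)
    (h : (ρ:ℝ) ^ (s:ℝ) * M = 1) : s ≤ dimH (Sig ρ M) := by
  have hρ := ρ.2.1
  have hρ1 := ρ.2.2
  let g : Seq ρ → ℕ → Fin M := fun x n => if h : x n < M then ⟨x n, h⟩ else ⟨0, by omega⟩
  let f : Seq ρ → ℝ := fun x => Real.ofDigits (g x)
  have hM0 : (0:ℝ) < M := by positivity
  have hinv : (ρ:ℝ) ^ (s:ℝ) = (M:ℝ)⁻¹ := eq_inv_of_mul_eq_one_left h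
  have hf : HolderOnWith 1 s f (Sig ρ M) := by
    intro x hx y hy
    by_cases hxy : x = y
    · subst hxy
      simp
    obtain ⟨n, h1, h2⟩ := seq_first x y hxy
    rw [edist_dist, edist_dist, seq_dist_eq x y n h1 h2, ENNReal.ofReal_rpow_of_nonneg (pow_nonneg hρ.le n) (NNReal.coe_nonneg s),
      ENNReal.coe_one, one_mul]
    apply ENNReal.ofReal_le_ofReal
    have : ((ρ:ℝ) ^ n) ^ (s:ℝ) = ((M:ℝ) ^ n)⁻¹ := by
      rw [← Real.rpow_natCast, ← Real.rpow_mul hρ.le, mul_comm, Real.rpow_mul hρ.le, hinv,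
        Real.rpow_natCast, inv_pow]
    rw [this, Real.dist_eq]
    apply Real.abs_ofDigits_sub_ofDigits_le
    intro i hi
    simp only [g, h1 i hi]
  have h1 := hf.dimH_image_le hs
  have h2 : Set.Icc (0:ℝ) 1 ⊆ f '' Sig ρ M := by
    intro y hy
    obtain ⟨d, -, hd⟩ := Real.ofDigits_SurjOn (b := M) (by omega) hy
    refine ⟨fun n => (d n : ℕ), fun n => (d n).2, ?_⟩
    rw [← hd]
    show Real.ofDigits _ = _
    congr 1
    funext n
    have : ((d n : ℕ)) < M := (d n).2
    simp only [g]
    rw [dif_pos this]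
  have h3 : dimH (Set.Icc (0:ℝ) 1) = 1 := by
    rw [Real.dimH_of_nonempty_interior]
    · simp
    · rw [interior_Icc]
      exact ⟨1/2, by norm_num, by norm_num⟩
  have h4 : 1 ≤ dimH (Sig ρ M) / s := by
    rw [← h3]
    exact (dimH_mono h2).trans h1
  rw [ENNReal.le_div_iff_mul_le (Or.inl (by simpa using hs.ne')) (Or.inl (by simp)), one_mul] at h4
  exact h4

theorem sig_dim_inj (ρ : Set.Ioo (0:ℝ) 1) {M M' : ℕ} (hM : 2 ≤ M) (hM' : 2 ≤ M')
    (h : dimH (Sig ρ M) = dimH (Sig ρ M')) : M = M' := by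
  have hρ := ρ.2.1
  have hρ1 := ρ.2.2
  have ex : ∀ M : ℕ, 2 ≤ M → ∃ s : NNReal, 0 < s ∧ (ρ:ℝ) ^ (s:ℝ) * M = 1 := by
    intro M hM
    have hlog : Real.log ρ < 0 := Real.log_neg hρ hρ1
    have hlM : 0 < Real.log M := Real.log_pos (by exact_mod_cast (by omega : 1 < M))
    have hpos : 0 < Real.log M / (-Real.log ρ) := div_pos hlM (by linarith)
    refine ⟨⟨_, hpos.le⟩, hpos, ?_⟩
    have hM0 : (0:ℝ) < M := by positivity
    rw [Real.rpow_def_of_pos hρ]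
    show Real.exp (Real.log ρ * (Real.log M / (-Real.log ρ))) * M = 1
    have : Real.log ρ * (Real.log M / (-Real.log ρ)) = - Real.log M := by
      have hne := hlog.ne
      field_simp
    rw [this, Real.exp_neg, Real.exp_log hM0, inv_mul_cancel₀ hM0.ne']
  obtain ⟨s, hs, e⟩ := ex M hM
  obtain ⟨s', hs', e'⟩ := ex M' hM'
  have d1 : dimH (Sig ρ M) = s := le_antisymm (sig_dim_le ρ M s e) (sig_dim_ge ρ M hM s hs e)
  have d2 : dimH (Sig ρ M') = s' :=
    le_antisymm (sig_dim_le ρ M' s' e') (sig_dim_ge ρ M' hM' s' hs' e')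
  rw [d1, d2] at h
  have hss : s = s' := by exact_mod_cast h
  subst hss
  have hne : (ρ:ℝ) ^ (s:ℝ) ≠ 0 := (Real.rpow_pos_of_pos hρ _).ne'
  have := mul_left_cancel₀ hne (e.trans e'.symm)
  exact_mod_cast this
end GDP


namespace GDP

def ofGD {X : Type*} [MetricSpace X] {p : ℕ} {r : ℝ} (G : GraphDirected X p r) :
    GDS X (Fin p) r G.K where
  Ed := fun i => Σ j, Fin (G.a i j)
  fin := fun i => inferInstance
  tgt := fun _ e => e.1
  S := fun i e => G.S i e.1 e.2
  sim := fun i e x y => G.sim i e.1 e.2 x y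
  union := by
    intro i
    refine (G.union i).trans ?_
    rw [Set.iUnion_sigma]
  disj := fun i e e' h => G.disj i e.1 e'.1 e.2 e'.2 h

theorem ofGD_counts {X : Type*} [MetricSpace X] {p : ℕ} {r : ℝ} (G : GraphDirected X p r) :
    (ofGD G).Counts (Matrix.of G.a) := by
  intro t f
  show ∑ e : (Σ j, Fin (G.a t j)), f e.1 = _
  rw [Fintype.sum_sigma]
  simp

theorem mem_sig {X : Type*} [MetricSpace X] {r : ℝ} (hr : 0 < r) {m : ℕ} (hm : 2 ≤ m)
    {K : Set X} (hK : MemGDClass K r m) :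
    ∃ k n₁ : ℕ, 0 < k ∧ ∀ n, n₁ ≤ n → 0 < n → ∀ ρ : Set.Ioo (0:ℝ) 1, (ρ:ℝ) = r ^ (k * n) →
      BE K (Sig ρ (m ^ (k * n))) := by
  obtain ⟨p, hp, G, ⟨v, hv, hev⟩, rfl⟩ := hK
  obtain ⟨u, hu, heu⟩ := int_eigen G.a m v hv hev
  obtain ⟨k, n₁, hk, h⟩ := good_all hr (ofGD G) (Matrix.of G.a) (ofGD_counts G) G.compact
    G.nonempty u hu m hm heu
  exact ⟨k, n₁, hk, fun n h1 h2 ρ hρ => h n h1 h2 ρ hρ _⟩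

end GDP

/-- **Rigidity with a fixed ratio.** Fix `r ∈ (0,1)`. For `K ∈ 𝔄_{m₁}^{r}` and
`K' ∈ 𝔄_{m₂}^{r}` (`m₁, m₂ ≥ 2` integers), `K` and `K'` are bilipschitz
equivalent iff they have the same Hausdorff dimension, equivalently iff
`m₁ = m₂`. -/
theorem gdClass_fixed_ratio_bilip_iff_dimH
    {X X' : Type*} [MetricSpace X] [CompactSpace X] [MetricSpace X'] [CompactSpace X']
    {r : ℝ} (hr : r ∈ Set.Ioo (0 : ℝ) 1)
    {m₁ m₂ : ℕ} (hm₁ : 2 ≤ m₁) (hm₂ : 2 ≤ m₂)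
    {K : Set X} {K' : Set X'}
    (hK : MemGDClass K r m₁) (hK' : MemGDClass K' r m₂) :
    (BilipEquivSets K K' ↔ dimH K = dimH K') ∧
    (BilipEquivSets K K' ↔ m₁ = m₂) := by
  obtain ⟨k, n, hk, h⟩ := GDP.mem_sig hr.1 hm₁ hK
  obtain ⟨k', n', hk', h'⟩ := GDP.mem_sig hr.1 hm₂ hK'
  have hq : k * (k' * (n + n' + 1)) ≠ 0 := by positivity
  have e : k' * (k * (n + n' + 1)) = k * (k' * (n + n' + 1)) := by ring
  obtain ⟨q, hqd⟩ : ∃ q, q = k * (k' * (n + n' + 1)) := ⟨_, rfl⟩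
  have b1 := h (k' * (n + n' + 1)) (by nlinarith) (by positivity)
  have b2 := h' (k * (n + n' + 1)) (by nlinarith) (by positivity)
  rw [e] at b2
  rw [← hqd] at b1 b2 hq
  let ρ : Set.Ioo (0:ℝ) 1 := ⟨r ^ q, pow_pos hr.1 q, pow_lt_one₀ hr.1.le hr.2 hq⟩
  have c1 := b1 ρ rfl
  have c2 := b2 ρ rfl
  have i1 : BilipEquivSets K K' → dimH K = dimH K' := fun hb => (GDP.BE.of_sets hb).dimH_eq
  have i2 : dimH K = dimH K' → m₁ = m₂ := by
    intro hd
    rw [c1.dimH_eq, c2.dimH_eq] at hd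
    have p1 : 2 ≤ m₁ ^ q := hm₁.trans (Nat.le_self_pow hq _)
    have p2 : 2 ≤ m₂ ^ q := hm₂.trans (Nat.le_self_pow hq _)
    exact Nat.pow_left_injective hq (GDP.sig_dim_inj ρ p1 p2 hd)
  have i3 : m₁ = m₂ → BilipEquivSets K K' := by
    intro hm
    subst hm
    exact (c1.trans c2.symm).sets
  exact ⟨⟨i1, fun hd => i3 (i2 hd)⟩, ⟨fun hb => i2 (i1 hb), i3⟩⟩
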